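/- For every n with 5 ≤ n ≤ 511 and all points p_1,…,p_n in general position in P^3, the radical ideal I = ∩_{j=1}^n m_{p_j} ⊆ k[P^3] satisfies I^(3r) ⊆ M^{2r}·I^r for all integers r ≥ 1. -/

import Mathlib

open MvPolynomial Filter

/-- The homogeneous ideal of all forms vanishing at the (projective) point with
coordinate vector `p`. -/
noncomputable def pointIdeal {k : Type*} [Field k] {σ : Type*} (p : σ → k) :
    Ideal (MvPolynomial σ k) :=
  Ideal.span { f | (∃ d, f.IsHomogeneous d) ∧ eval p f = 0 }

/-- The fat points ideal `⋂ⱼ m_{pⱼ}^{mⱼ}` (natural multiplicities). -/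
noncomputable def fatIdeal {k : Type*} [Field k] {N n : ℕ} (p : Fin n → (Fin (N + 1) → k))
    (m : Fin n → ℕ) : Ideal (MvPolynomial (Fin (N + 1)) k) :=
  ⨅ j, pointIdeal (p j) ^ (m j)

/-- The fat points ideal with integer multiplicities, with the convention
`m_p^m = (1)` for `m ≤ 0`. -/
noncomputable def fatIdealZ {k : Type*} [Field k] {N n : ℕ} (p : Fin n → (Fin (N + 1) → k))
    (m : Fin n → ℤ) : Ideal (MvPolynomial (Fin (N + 1)) k) :=
  ⨅ j, pointIdeal (p j) ^ (m j).toNat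

/-- The irrelevant maximal ideal `M = (x_0, …, x_N)`. -/
noncomputable def maxIdeal (k : Type*) [Field k] (N : ℕ) : Ideal (MvPolynomial (Fin (N + 1)) k) :=
  Ideal.span (Set.range X)

/-- `α(I)`: the least `t ≥ 0` such that `I` contains a nonzero form of degree `t`. -/
noncomputable def alpha {k : Type*} [Field k] {σ : Type*}
    (I : Ideal (MvPolynomial σ k)) : ℕ :=
  sInf { t | ∃ f ∈ I, f ≠ 0 ∧ f.IsHomogeneous t }

/-- The sequence `t ↦ α(I^{(t)})/t` attached to the fat points ideal with points `p`
and multiplicities `m`; its limit as `t → ∞` is the Waldschmidt constant `γ`. -/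
noncomputable def alphaSeq {k : Type*} [Field k] {N n : ℕ}
    (p : Fin n → (Fin (N + 1) → k)) (m : Fin n → ℕ) (t : ℕ) : ℝ :=
  (alpha (fatIdeal p fun j => t * m j) : ℝ) / t

/-- `P` holds for `n`-tuples of points of `P^N` in general position: there is a
nonempty Zariski-open subset (the complement of the zero locus of a set `S` of
polynomials in the coordinates of the tuple) of tuples of nonzero coordinate
vectors on which `P` holds. -/
def Generic (k : Type*) [Field k] (N n : ℕ)
    (P : (Fin n → (Fin (N + 1) → k)) → Prop) : Prop :=
  ∃ S : Set (MvPolynomial (Fin n × Fin (N + 1)) k),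
    (∃ p : Fin n → (Fin (N + 1) → k), (∀ j, p j ≠ 0) ∧
      ∃ f ∈ S, eval (fun q => p q.1 q.2) f ≠ 0) ∧
    ∀ p : Fin n → (Fin (N + 1) → k), (∀ j, p j ≠ 0) →
      (∃ f ∈ S, eval (fun q => p q.1 q.2) f ≠ 0) → P p

namespace FP

/-- The affine coordinate ring. -/
abbrev A3 (k : Type*) [Field k] := MvPolynomial (Fin 3) k

variable {k : Type*} [Field k]

/-- maximal ideal of an affine point -/
noncomputable def mx (q : Fin 3 → k) : Ideal (A3 k) :=
  Ideal.span (Set.range fun i => X i - C (q i))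

/-- translation -/
noncomputable def tr (q : Fin 3 → k) : A3 k →ₐ[k] A3 k := aeval (fun i => X i + C (q i))

/-- polynomials of degree at most `T` -/
noncomputable def PD (k : Type*) [Field k] (T : ℕ) : Submodule k (A3 k) :=
  restrictTotalDegree (Fin 3) k T

lemma mem_PD {T : ℕ} {f : A3 k} : f ∈ PD k T ↔ f.totalDegree ≤ T := mem_restrictTotalDegree _ _ _

instance (T : ℕ) : Module.Finite k (PD k T) :=
  inferInstanceAs (Module.Finite k (restrictTotalDegree (Fin 3) k T))

lemma PD_mul {S T : ℕ} {f g : A3 k} (hf : f ∈ PD k S) (hg : g ∈ PD k T) : f * g ∈ PD k (S + T) := by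
  rw [mem_PD] at *
  exact (totalDegree_mul _ _).trans (by omega)

lemma PD_mono {S T : ℕ} (h : S ≤ T) : PD k S ≤ PD k T := by
  intro f hf
  rw [mem_PD] at *
  omega

lemma C_mem_PD (c : k) (T : ℕ) : (C c : A3 k) ∈ PD k T := by simp [mem_PD]
lemma one_mem_PD (T : ℕ) : (1 : A3 k) ∈ PD k T := by simp [mem_PD]
lemma X_mem_PD (i : Fin 3) : (X i : A3 k) ∈ PD k 1 := by simp [mem_PD]
lemma lin_mem_PD (i : Fin 3) (c : k) : (X i - C c : A3 k) ∈ PD k 1 :=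
  Submodule.sub_mem _ (X_mem_PD i) (C_mem_PD c 1)

lemma PD_prod {ι : Type*} (s : Finset ι) (f : ι → A3 k) (d : ι → ℕ) (h : ∀ i ∈ s, f i ∈ PD k (d i)) :
    ∏ i ∈ s, f i ∈ PD k (∑ i ∈ s, d i) := by
  classical
  induction s using Finset.induction_on with
  | empty => simpa using one_mem_PD 0
  | insert a s ha ih =>
    rw [Finset.prod_insert ha, Finset.sum_insert ha]
    exact PD_mul (h _ (by simp)) (ih fun i hi => h i (by simp [hi]))

lemma PD_pow {d : ℕ} {f : A3 k} (h : f ∈ PD k d) (m : ℕ) : f ^ m ∈ PD k (m * d) := by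
  have := PD_prod (Finset.range m) (fun _ => f) (fun _ => d) (fun _ _ => h)
  simpa using this

lemma tr_tr_neg (q : Fin 3 → k) (f : A3 k) : tr q (tr (-q) f) = f := by
  have : (tr q).comp (tr (-q)) = AlgHom.id k _ := by
    ext i; simp [tr]
  exact DFunLike.congr_fun this f

lemma tr_neg_tr (q : Fin 3 → k) (f : A3 k) : tr (-q) (tr q f) = f := by
  have := tr_tr_neg (-q) f
  rwa [neg_neg] at this

lemma tr_mem {q : Fin 3 → k} {m : ℕ} {f : A3 k} (h : f ∈ mx q ^ m) :
    tr q f ∈ idealOfVars (Fin 3) k ^ m := by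
  have h1 := Ideal.mem_map_of_mem (tr q) h
  rw [Ideal.map_pow] at h1
  refine Ideal.pow_right_mono ?_ m h1
  rw [mx, Ideal.map_span, Ideal.span_le]
  rintro _ ⟨_, ⟨i, rfl⟩, rfl⟩
  simp only [tr, map_sub, aeval_X, SetLike.mem_coe]
  have : (X i + C (q i) - (aeval fun i => X i + C (q i)) (C (q i)) : A3 k) = X i := by
    rw [← algebraMap_eq, AlgHom.commutes]; simp
  rw [this]
  exact Ideal.subset_span ⟨i, rfl⟩

lemma tr_neg_mem {q : Fin 3 → k} {m : ℕ} {f : A3 k} (h : f ∈ idealOfVars (Fin 3) k ^ m) :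
    tr (-q) f ∈ mx q ^ m := by
  have h1 := Ideal.mem_map_of_mem (tr (-q)) h
  rw [Ideal.map_pow] at h1
  refine Ideal.pow_right_mono ?_ m h1
  rw [idealOfVars, Ideal.map_span, Ideal.span_le]
  rintro _ ⟨_, ⟨i, rfl⟩, rfl⟩
  simp only [tr, aeval_X, SetLike.mem_coe]
  refine Ideal.subset_span ⟨i, ?_⟩
  simp [sub_eq_add_neg]

lemma mem_mx_iff {q : Fin 3 → k} {m : ℕ} {f : A3 k} :
    f ∈ mx q ^ m ↔ ∀ α : Fin 3 →₀ ℕ, α.degree < m → coeff α (tr q f) = 0 := by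
  rw [← mem_pow_idealOfVars_iff']
  refine ⟨tr_mem, fun h => ?_⟩
  have := tr_neg_mem (q := q) h
  rwa [tr_neg_tr] at this

lemma tr_PD {q : Fin 3 → k} {T : ℕ} {f : A3 k} (h : f ∈ PD k T) : tr q f ∈ PD k T := by
  have : tr q f = ∑ α ∈ f.support, C (coeff α f) * ∏ i, (X i + C (q i)) ^ α i := by
    conv_lhs => rw [f.as_sum]
    rw [map_sum]
    refine Finset.sum_congr rfl fun α _ => ?_
    simp only [tr, aeval_monomial, algebraMap_eq]
    rw [Finsupp.prod_fintype]
    simp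
  rw [this]
  refine Submodule.sum_mem _ fun α hα => ?_
  have h2 : ∑ i, α i * 1 ≤ T := by
    rw [mem_PD] at h
    have := le_totalDegree hα
    rw [Finsupp.sum_fintype _ _ (by simp)] at this
    simp only [mul_one]
    exact this.trans h
  refine PD_mono h2 ?_
  rw [← zero_add (∑ i, _)]
  refine PD_mul (C_mem_PD _ _) (PD_prod _ _ _ fun i _ => PD_pow ?_ _)
  exact Submodule.add_mem _ (X_mem_PD i) (C_mem_PD _ 1)

lemma eval_tr (q : Fin 3 → k) (f : A3 k) : coeff 0 (tr q f) = eval q f := by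
  have : (constantCoeff : A3 k →+* k).comp (tr q).toRingHom = eval q := by
    ext i <;> simp [tr]
  exact DFunLike.congr_fun this f

lemma mem_mx_one {q : Fin 3 → k} {f : A3 k} : f ∈ mx q ↔ eval q f = 0 := by
  rw [← pow_one (mx q), mem_mx_iff, ← eval_tr]
  constructor
  · intro h; exact h 0 (by simp)
  · intro h α hα
    have : α = 0 := (Finsupp.degree_eq_zero_iff α).1 (by omega)
    rw [this, h]

lemma mx_pow_anti (q : Fin 3 → k) {m n : ℕ} (h : m ≤ n) : mx q ^ n ≤ mx q ^ m := Ideal.pow_le_pow_right h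

/-- `mx`-adic cancellation of a unit. -/
lemma mx_cancel {q : Fin 3 → k} {m : ℕ} {f g : A3 k} (hf : eval q f ≠ 0) (h : f * g ∈ mx q ^ m) :
    g ∈ mx q ^ m := by
  induction m with
  | zero => simp
  | succ m ih =>
    have hg : g ∈ mx q ^ m := ih (mx_pow_anti q (Nat.le_succ m) h)
    have h1 : f - C (eval q f) ∈ mx q := by rw [mem_mx_one]; simp
    have h2 : (f - C (eval q f)) * g ∈ mx q ^ (m + 1) := by
      rw [pow_succ']; exact Ideal.mul_mem_mul h1 hg
    have h3 : C (eval q f) * g ∈ mx q ^ (m+1) := by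
      have := Ideal.sub_mem _ h h2
      convert this using 1; ring
    have h4 := Ideal.mul_mem_left _ (C (eval q f)⁻¹) h3
    rwa [← mul_assoc, ← C_mul, inv_mul_cancel₀ hf, C_1, one_mul] at h4

lemma mul_mem_mx {q : Fin 3 → k} {a b c : ℕ} {f g : A3 k} (hf : f ∈ mx q ^ a) (hg : g ∈ mx q ^ b)
    (h : c ≤ a + b) : f * g ∈ mx q ^ c := by
  refine mx_pow_anti q h ?_
  rw [pow_add]; exact Ideal.mul_mem_mul hf hg

/-- Taylor truncation. -/
lemma taylor (q : Fin 3 → k) (b : ℕ) (r : A3 k) :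
    ∃ g ∈ PD k b, r - g ∈ mx q ^ (b + 1) := by
  refine ⟨tr (-q) (∑ α ∈ (tr q r).support with α.degree ≤ b, monomial α (coeff α (tr q r))), ?_, ?_⟩
  · refine tr_PD (Submodule.sum_mem _ fun α hα => ?_)
    rw [mem_PD]
    refine (totalDegree_monomial_le _ _).trans ?_
    simp only [Finset.mem_filter] at hα
    exact hα.2
  · rw [mem_mx_iff]
    intro α hα
    rw [map_sub, tr_tr_neg, coeff_sub, coeff_sum]
    classical
    rw [Finset.sum_congr rfl fun x _ => coeff_monomial α x _]
    rw [Finset.sum_ite_eq']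
    simp only [Finset.mem_filter, mem_support_iff]
    split_ifs with h
    · simp
    · have : coeff α (tr q r) = 0 := by
        by_contra h'
        exact h ⟨h', by omega⟩
      simp [this]

end FP

namespace FP
variable {k : Type*} [Field k]

/-- evaluation of a polynomial in the coordinates at a configuration -/
noncomputable abbrev evc {n : ℕ} (q : Fin n → Fin 3 → k) (Φ : MvPolynomial (Fin n × Fin 3) k) : k :=
  eval (fun x => q x.1 x.2) Φ

/-- affine general position -/
def GenA (k : Type*) [Field k] (n : ℕ) (P : (Fin n → Fin 3 → k) → Prop) : Prop :=
  ∃ Φ : MvPolynomial (Fin n × Fin 3) k, Φ ≠ 0 ∧ ∀ q, evc q Φ ≠ 0 → P q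

lemma GenA.mono {n : ℕ} {P Q : (Fin n → Fin 3 → k) → Prop} (h : GenA k n P) (hPQ : ∀ q, P q → Q q) :
    GenA k n Q := by
  obtain ⟨Φ, h1, h2⟩ := h
  exact ⟨Φ, h1, fun q hq => hPQ q (h2 q hq)⟩

lemma GenA.and {n : ℕ} {P Q : (Fin n → Fin 3 → k) → Prop} (h : GenA k n P) (h' : GenA k n Q) :
    GenA k n (fun q => P q ∧ Q q) := by
  obtain ⟨Φ, h1, h2⟩ := h
  obtain ⟨Ψ, h3, h4⟩ := h'
  refine ⟨Φ * Ψ, mul_ne_zero h1 h3, fun q hq => ?_⟩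
  simp only [evc, map_mul, ne_eq, mul_eq_zero, not_or] at hq
  exact ⟨h2 q hq.1, h4 q hq.2⟩

lemma GenA.pull {n n' : ℕ} {P : (Fin n → Fin 3 → k) → Prop} (h : GenA k n P) (e : Fin n ↪ Fin n') :
    GenA k n' (fun q => P (fun j => q (e j))) := by
  obtain ⟨Φ, h1, h2⟩ := h
  refine ⟨rename (fun x => (e x.1, x.2)) Φ, ?_, fun q hq => h2 _ ?_⟩
  · intro h0
    apply h1
    have hi : Function.Injective (fun x : Fin n × Fin 3 => (e x.1, x.2)) := by
      rintro ⟨a, b⟩ ⟨c, d⟩ h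
      simpa using h
    exact rename_injective _ hi (by simpa using h0)
  · rw [evc, eval_rename] at hq
    exact hq

lemma GenA_surj {n : ℕ} {ι κ : Type*} [Fintype ι] [Fintype κ] [DecidableEq ι] [DecidableEq κ]
    (L : (Fin n → Fin 3 → k) → (κ → k) →ₗ[k] (ι → k))
    (hp : ∀ i c, ∃ P, ∀ q, L q (Pi.single c 1) i = evc q P)
    (q0 : Fin n → Fin 3 → k) (h : Function.Surjective (L q0)) :
    GenA k n (fun q => Function.Surjective (L q)) := by
  choose P hP using hp
  obtain ⟨B, hB⟩ := (L q0).exists_rightInverse_of_surjective (LinearMap.range_eq_top.2 h)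
  let M : Matrix ι κ (MvPolynomial (Fin n × Fin 3) k) := Matrix.of P
  let B' : Matrix κ ι (MvPolynomial (Fin n × Fin 3) k) := (LinearMap.toMatrix' B).map C
  have key : ∀ q, evc q (M * B').det = LinearMap.det ((L q) ∘ₗ B) := by
    intro q
    rw [evc, RingHom.map_det, ← LinearMap.det_toMatrix', LinearMap.toMatrix'_comp]
    congr 1
    rw [RingHom.mapMatrix_apply, Matrix.map_mul]
    congr 1
    · ext i c
      simp [M, ← hP, LinearMap.toMatrix'_apply]
    · ext i c
      simp [B']
  refine ⟨(M * B').det, ?_, ?_⟩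
  · intro h0
    have := key q0
    rw [h0, hB] at this
    simp [evc] at this
  · intro q hq
    rw [key] at hq
    have h1 : Function.Surjective ((L q) ∘ₗ B) := by
      have := LinearMap.equivOfDetNeZero _ hq
      exact ((LinearMap.isUnit_iff_range_eq_top _).1 (by
        exact (LinearMap.isUnit_iff_isUnit_det _).2 (isUnit_iff_ne_zero.2 hq))) |> LinearMap.range_eq_top.1
    intro y
    obtain ⟨x, hx⟩ := h1 y
    exact ⟨B x, hx⟩

/-- exponents of degree `< m` -/
def lowf (m : ℕ) : Finset (Fin 3 →₀ ℕ) :=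
  (Finset.range m).biUnion fun d => Finset.finsuppAntidiag Finset.univ d

lemma mem_lowf {m : ℕ} {α : Fin 3 →₀ ℕ} : α ∈ lowf m ↔ α.degree < m := by
  simp only [lowf, Finset.mem_biUnion, Finset.mem_range, Finset.mem_finsuppAntidiag, Finset.subset_univ, and_true, Finsupp.degree_eq_sum]
  constructor
  · rintro ⟨d, h1, h2⟩; exact h2 ▸ h1
  · intro h; exact ⟨_, h, rfl⟩

lemma card_lowf (m : ℕ) : 6 * (lowf m).card = m * (m + 1) * (m + 2) := by
  induction m with
  | zero => simp [lowf]
  | succ m ih =>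
    have : lowf (m + 1) = lowf m ∪ Finset.finsuppAntidiag Finset.univ m := by
      simp only [lowf, Finset.range_add_one, Finset.biUnion_insert]
      rw [Finset.union_comm]
    rw [this, Finset.card_union_of_disjoint, mul_add, ih, Finset.card_finsuppAntidiag_nat_eq_choose]
    · have h2 := Nat.triangle_succ (m+1)
      have h3 : (m + 1 + 1).choose 2 * 2 = (m + 1 + 1) * (m + 1) := by
        rw [Nat.choose_two_right]
        exact Nat.div_mul_cancel (Nat.even_mul_pred_self _).two_dvd
      have h4 : (3 + m - 1).choose m = (m+1+1).choose 2 := by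
        rw [show 3 + m - 1 = m + 2 by omega, Nat.choose_symm_add]
      simp only [Finset.card_univ, Fintype.card_fin] at h4 ⊢
      nlinarith [h3, h4]
    · rw [Finset.disjoint_left]
      intro α h1 h2
      rw [mem_lowf] at h1
      rw [Finset.mem_finsuppAntidiag] at h2
      rw [Finsupp.degree_eq_sum] at h1
      have h3 : ∑ i, α i = m := h2.1
      omega

abbrev Idx (m : ℕ) := {α // α ∈ lowf m}

/-- parametrisation of `PD` -/
noncomputable def par (k : Type*) [Field k] (m : ℕ) : (Idx m → k) →ₗ[k] A3 k :=
  ∑ α : Idx m, (monomial α.1) ∘ₗ LinearMap.proj α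

lemma par_apply (m : ℕ) (c : Idx m → k) : par k m c = ∑ α, monomial α.1 (c α) := by
  simp [par]

lemma coeff_par (m : ℕ) (c : Idx m → k) (α : Idx m) : coeff α.1 (par k m c) = c α := by
  classical
  rw [par_apply, coeff_sum]
  simp only [coeff_monomial, Subtype.coe_inj]
  simp

lemma coeff_par_not (m : ℕ) (c : Idx m → k) (α : Fin 3 →₀ ℕ) (h : α ∉ lowf m) :
    coeff α (par k m c) = 0 := by
  classical
  rw [par_apply, coeff_sum]
  refine Finset.sum_eq_zero fun β _ => ?_
  rw [coeff_monomial, if_neg]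
  rintro rfl; exact h β.2

lemma par_mem (E : ℕ) (c : Idx (E + 1) → k) : par k (E + 1) c ∈ PD k E := by
  rw [par_apply]
  refine Submodule.sum_mem _ fun α _ => ?_
  rw [mem_PD]
  refine (totalDegree_monomial_le _ _).trans ?_
  have := mem_lowf.1 α.2
  exact Nat.lt_succ_iff.1 this

lemma par_surj {E : ℕ} {f : A3 k} (h : f ∈ PD k E) :
    par k (E + 1) (fun α => coeff α.1 f) = f := by
  ext α
  by_cases hα : α ∈ lowf (E + 1)
  · exact coeff_par _ _ ⟨α, hα⟩
  · rw [coeff_par_not _ _ _ hα]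
    rw [mem_lowf] at hα
    rw [mem_PD] at h
    refine (coeff_eq_zero_of_totalDegree_lt ?_).symm
    have : α.degree = ∑ i ∈ α.support, α i := rfl
    omega

lemma par_inj (m : ℕ) : Function.Injective (par k m) := by
  intro c d h
  funext α
  rw [← coeff_par m c, h, coeff_par]

lemma finrank_PD (E : ℕ) : Module.finrank k (PD k E) = (lowf (E + 1)).card := by
  have : PD k E = LinearMap.range (par k (E + 1)) := by
    ext f
    constructor
    · intro h; exact ⟨_, par_surj h⟩
    · rintro ⟨c, rfl⟩; exact par_mem E c
  rw [this, LinearMap.finrank_range_of_inj (par_inj _)]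
  simp

/-- jets -/
noncomputable def jet (q : Fin 3 → k) (m : ℕ) : A3 k →ₗ[k] (Idx m → k) :=
  LinearMap.pi fun α => (lcoeff k α.1) ∘ₗ (tr q).toLinearMap

lemma jet_apply (q : Fin 3 → k) (m : ℕ) (f : A3 k) (α : Idx m) : jet q m f α = coeff α.1 (tr q f) := rfl

lemma jet_eq_zero {q : Fin 3 → k} {m : ℕ} {f : A3 k} : jet q m f = 0 ↔ f ∈ mx q ^ m := by
  rw [mem_mx_iff]
  constructor
  · intro h α hα
    exact congrFun h ⟨α, mem_lowf.2 hα⟩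
  · intro h; funext α
    exact h α.1 (mem_lowf.1 α.2)

lemma jet_surj (q : Fin 3 → k) (m : ℕ) (c : Idx m → k) : ∃ f, jet q m f = c := by
  refine ⟨tr (-q) (par k m c), ?_⟩
  funext α
  rw [jet_apply, tr_tr_neg, coeff_par]

/-- Hermite interpolation in degree `E` is possible -/
def IndS {n : ℕ} (q : Fin n → Fin 3 → k) (E : ℕ) (m : Fin n → ℕ) : Prop :=
  ∀ v : Fin n → A3 k, ∃ g ∈ PD k E, ∀ j, g - v j ∈ mx (q j) ^ (m j)

/-- all jets -/
noncomputable def jets {n : ℕ} (q : Fin n → Fin 3 → k) (m : Fin n → ℕ) :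
    A3 k →ₗ[k] ((Σ j, Idx (m j)) → k) :=
  LinearMap.pi fun x => (LinearMap.proj x.2) ∘ₗ (jet (q x.1) (m x.1))

lemma jets_eq_zero {n : ℕ} {q : Fin n → Fin 3 → k} {m : Fin n → ℕ} {f : A3 k} :
    jets q m f = 0 ↔ ∀ j, f ∈ mx (q j) ^ (m j) := by
  constructor
  · intro h j
    rw [← jet_eq_zero]
    funext α
    exact congrFun h ⟨j, α⟩
  · intro h
    funext x
    have := jet_eq_zero.2 (h x.1)
    exact congrFun this x.2

lemma jets_surj_iff {n : ℕ} {q : Fin n → Fin 3 → k} {m : Fin n → ℕ} {E : ℕ} :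
    IndS q E m ↔ Function.Surjective ((jets q m) ∘ₗ (par k (E + 1))) := by
  constructor
  · intro h c
    choose v hv using fun j => jet_surj (q j) (m j) (fun α => c ⟨j, α⟩)
    obtain ⟨g, hg, hg'⟩ := h v
    refine ⟨fun α => coeff α.1 g, ?_⟩
    rw [LinearMap.comp_apply, par_surj hg]
    funext x
    have := jet_eq_zero.2 (hg' x.1)
    rw [map_sub, sub_eq_zero, hv] at this
    exact congrFun this x.2
  · intro h v
    obtain ⟨c, hc⟩ := h (fun x => jet (q x.1) (m x.1) (v x.1) x.2)
    refine ⟨par k (E + 1) c, par_mem _ _, fun j => ?_⟩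
    rw [← jet_eq_zero, map_sub, sub_eq_zero]
    funext α
    exact congrFun hc ⟨j, α⟩

/-- jet coefficients are polynomial in the point -/
lemma jet_poly {n : ℕ} (j : Fin n) (f : A3 k) (α : Fin 3 →₀ ℕ) :
    ∃ P : MvPolynomial (Fin n × Fin 3) k, ∀ q : Fin n → Fin 3 → k, coeff α (tr (q j) f) = evc q P := by
  let U : MvPolynomial (Fin 3) (MvPolynomial (Fin n × Fin 3) k) := eval₂ (C.comp C) (fun i => X i + C (X (j, i))) f
  refine ⟨coeff α U, fun q => ?_⟩
  rw [evc, ← coeff_map]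
  congr 1
  have : (MvPolynomial.map (eval fun x : Fin n × Fin 3 => q x.1 x.2)).comp
      (eval₂Hom (C.comp C) (fun i => X i + C (X (j, i))) : A3 k →+* MvPolynomial (Fin 3) (MvPolynomial (Fin n × Fin 3) k))
      = (tr (q j)).toRingHom := by
    ext i <;> simp [tr]
  exact (DFunLike.congr_fun this f).symm

lemma GenA_IndS {n : ℕ} {q0 : Fin n → Fin 3 → k} {m : Fin n → ℕ} {E : ℕ} (h : IndS q0 E m) :
    GenA k n (fun q => IndS q E m) := by
  simp only [jets_surj_iff] at *
  refine GenA_surj (fun q => jets q m ∘ₗ par k (E + 1)) ?_ q0 h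
  intro x c
  obtain ⟨P, hP⟩ := jet_poly x.1 (par k (E + 1) (Pi.single c 1)) x.2.1
  exact ⟨P, fun q => hP q⟩

end FP

namespace FP
variable {k : Type*} [Field k]

lemma IndS_step {n : ℕ} {q : Fin n → Fin 3 → k} {E E' : ℕ} {m m' : Fin n → ℕ} (hE : E ≤ E')
    (hm : ∀ j, m j ≤ m' j) (h0 : IndS q E m)
    (h : ∀ j b, m j ≤ b → b < m' j → ∀ r ∈ mx (q j) ^ b, ∃ g ∈ PD k E',
      (∀ i, i ≠ j → g ∈ mx (q i) ^ (m' i)) ∧ r - g ∈ mx (q j) ^ (b + 1)) : IndS q E' m' := by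
  intro v
  obtain ⟨g0, hg0, hg0'⟩ := h0 v
  have key : ∀ j, ∃ g ∈ PD k E', (∀ i, i ≠ j → g ∈ mx (q i) ^ (m' i)) ∧
      v j - g0 - g ∈ mx (q j) ^ (m' j) := by
    intro j
    have aux : ∀ c, m j + c ≤ m' j → ∃ g ∈ PD k E', (∀ i, i ≠ j → g ∈ mx (q i) ^ (m' i)) ∧
      v j - g0 - g ∈ mx (q j) ^ (m j + c) := by
      intro c
      induction c with
      | zero =>
        intro _
        refine ⟨0, Submodule.zero_mem _, fun _ _ => Ideal.zero_mem _, ?_⟩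
        have := Ideal.neg_mem_iff _ |>.2 (hg0' j)
        simpa using this
      | succ c ih =>
        intro hc
        obtain ⟨g, h1, h2, h3⟩ := ih (by omega)
        obtain ⟨g', h1', h2', h3'⟩ := h j (m j + c) (by omega) (by omega) _ h3
        refine ⟨g + g', Submodule.add_mem _ h1 h1', fun i hi => Ideal.add_mem _ (h2 i hi) (h2' i hi), ?_⟩
        rw [← add_assoc]
        convert h3' using 1
        ring
    obtain ⟨c, hc⟩ := Nat.exists_eq_add_of_le (hm j)
    rw [hc]
    have := aux c hc.ge
    obtain ⟨g, h1, h2, h3⟩ := this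
    exact ⟨g, h1, h2, h3⟩
  choose g hg1 hg2 hg3 using key
  refine ⟨g0 + ∑ j, g j, Submodule.add_mem _ (PD_mono hE hg0) (Submodule.sum_mem _ fun j _ => hg1 j), fun j => ?_⟩
  have e : g0 + ∑ i, g i - v j = -(v j - g0 - g j) + ∑ i ∈ Finset.univ.erase j, g i := by
    rw [← Finset.add_sum_erase _ _ (Finset.mem_univ j)]
    ring
  rw [e]
  refine Ideal.add_mem _ (Ideal.neg_mem_iff _ |>.2 (hg3 j)) (Ideal.sum_mem _ fun i hi => hg2 i j ?_)
  exact (Finset.ne_of_mem_erase hi).symm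

lemma IndS_mul_aux {n : ℕ} {q : Fin n → Fin 3 → k} {e : ℕ} {w : Fin n → ℕ}
    (h : IndS q e (fun j => w j + 1)) (N : ℕ) : ∀ j b, b ≤ w j * (N + 1) → ∀ r ∈ mx (q j) ^ b,
      ∃ g ∈ PD k (e * (N + 1)), (∀ i, i ≠ j → g ∈ mx (q i) ^ (w i * (N + 1) + 1)) ∧
        r - g ∈ mx (q j) ^ (b + 1) := by
  have base : ∀ j b, b ≤ w j → ∀ r ∈ mx (q j) ^ b,
      ∃ g ∈ PD k e, (∀ i, i ≠ j → g ∈ mx (q i) ^ (w i + 1)) ∧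
        r - g ∈ mx (q j) ^ (b + 1) := by
    intro j b hb r hr
    obtain ⟨g, h1, h2⟩ := h (fun i => if i = j then r else 0)
    refine ⟨g, h1, fun i hi => ?_, ?_⟩
    · have := h2 i
      simpa [hi] using this
    · have := h2 j
      rw [if_pos rfl, ← Ideal.neg_mem_iff, neg_sub] at this
      exact mx_pow_anti _ (by simpa using hb) this
  induction N with
  | zero => simpa using base
  | succ N ih =>
    intro j b hb r hr
    obtain ⟨b1, b2, rfl, hb1, hb2⟩ : ∃ b1 b2, b = b1 + b2 ∧ b1 ≤ w j ∧ b2 ≤ w j * (N + 1) := by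
      by_cases hbw : b ≤ w j
      · exact ⟨b, 0, rfl, hbw, by omega⟩
      · refine ⟨w j, b - w j, by omega, le_rfl, ?_⟩
        have : w j * (N + 1 + 1) = w j * (N + 1) + w j := by ring
        omega
    rw [pow_add] at hr
    induction hr using Submodule.mul_induction_on' with
    | mem_mul_mem r1 hr1 r2 hr2 =>
      obtain ⟨g1, u1, u2, u3⟩ := base j b1 hb1 r1 hr1
      obtain ⟨g2, v1, v2, v3⟩ := ih j b2 hb2 r2 hr2
      have hg1 : g1 ∈ mx (q j) ^ b1 := by
        have := Ideal.sub_mem _ hr1 (mx_pow_anti _ (Nat.le_succ b1) u3)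
        simpa using this
      refine ⟨g1 * g2, PD_mono (by ring_nf; rfl) (PD_mul u1 v1), fun i hi => ?_, ?_⟩
      · exact mul_mem_mx (u2 i hi) (v2 i hi) (by ring_nf; omega)
      · have : r1 * r2 - g1 * g2 = (r1 - g1) * r2 + g1 * (r2 - g2) := by ring
        rw [this]
        exact Ideal.add_mem _ (mul_mem_mx u3 hr2 (by omega)) (mul_mem_mx hg1 v3 (by omega))
    | add x hx y hy ihx ihy =>
      obtain ⟨g1, u1, u2, u3⟩ := ihx
      obtain ⟨g2, v1, v2, v3⟩ := ihy
      refine ⟨g1 + g2, Submodule.add_mem _ u1 v1, fun i hi => Ideal.add_mem _ (u2 i hi) (v2 i hi), ?_⟩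
      have : x + y - (g1 + g2) = (x - g1) + (y - g2) := by ring
      rw [this]
      exact Ideal.add_mem _ u3 v3

lemma IndS_mul {n : ℕ} {q : Fin n → Fin 3 → k} {e : ℕ} {w : Fin n → ℕ}
    (h : IndS q e (fun j => w j + 1)) (N : ℕ) : IndS q (e * (N + 1)) (fun j => w j * (N + 1) + 1) := by
  refine IndS_step (E := 0) (m := 0) (Nat.zero_le _) (fun j => Nat.zero_le _) ?_ ?_
  · intro v
    exact ⟨0, Submodule.zero_mem _, fun j => by simp⟩
  · intro j b _ hb r hr
    exact IndS_mul_aux h N j b (by omega) r hr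

lemma volume_ineq {n : ℕ} {q : Fin n → Fin 3 → k} {E E' t M : ℕ} {m : Fin n → ℕ}
    (h : IndS q E m) {F : A3 k} (hF : F ≠ 0) (hFt : F ∈ PD k t) (hFM : ∀ j, F ∈ mx (q j) ^ M)
    (hE : E = t + E') :
    ∑ j, (lowf (m j)).card + (lowf (E' + 1)).card ≤
      (lowf (E + 1)).card + ∑ j, (lowf (m j - M)).card := by
  let T := (jets q m).domRestrict (PD k E)
  let T' := (jets q (fun j => m j - M)).domRestrict (PD k E')
  have h1 := T.finrank_range_add_finrank_ker
  have h2 := T'.finrank_range_add_finrank_ker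
  rw [finrank_PD] at h1 h2
  have hT : Function.Surjective T := by
    intro c
    obtain ⟨a, ha⟩ := jets_surj_iff.1 h c
    exact ⟨⟨par k (E + 1) a, par_mem _ _⟩, ha⟩
  rw [LinearMap.range_eq_top.2 hT, finrank_top] at h1
  have h3 : Module.finrank k (LinearMap.range T') ≤ ∑ j, (lowf (m j - M)).card := by
    refine (Submodule.finrank_le _).trans ?_
    simp
  have h4 : Module.finrank k ((Σ j, Idx (m j)) → k) = ∑ j, (lowf (m j)).card := by
    simp
  have h5 : Module.finrank k (LinearMap.ker T') ≤ Module.finrank k (LinearMap.ker T) := by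
    have hmem : ∀ x : PD k E', T' x = 0 → ∃ y : LinearMap.ker T, (y.1 : A3 k) = F * x.1 := by
      intro x hx
      refine ⟨⟨⟨F * x.1, hE ▸ PD_mul hFt x.2⟩, ?_⟩, rfl⟩
      rw [LinearMap.mem_ker]
      refine jets_eq_zero.2 fun j => ?_
      exact mul_mem_mx (hFM j) (jets_eq_zero.1 hx j) (by omega)
    let φ : LinearMap.ker T' →ₗ[k] A3 k :=
      (LinearMap.mulLeft k F) ∘ₗ (PD k E').subtype ∘ₗ (LinearMap.ker T').subtype
    let ψ : LinearMap.ker T →ₗ[k] A3 k := (PD k E).subtype ∘ₗ (LinearMap.ker T).subtype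
    have hφ : Function.Injective φ := by
      intro a b hab
      have : F * (a.1 : A3 k) = F * (b.1 : A3 k) := hab
      exact Subtype.ext (Subtype.ext (mul_left_cancel₀ hF this))
    have hψ : Function.Injective ψ := by
      intro a b hab
      exact Subtype.ext (Subtype.ext hab)
    rw [← LinearMap.finrank_range_of_inj hφ, ← LinearMap.finrank_range_of_inj hψ]
    refine Submodule.finrank_mono ?_
    rintro _ ⟨x, rfl⟩
    obtain ⟨y, hy⟩ := hmem x.1 x.2
    exact ⟨y, hy⟩
  omega

lemma volume_bound {n : ℕ} {q : Fin n → Fin 3 → k} {e : ℕ} {w : Fin n → ℕ} (he : 1 ≤ e)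
    (h : IndS q e (fun j => w j + 1)) {t M : ℕ} {F : A3 k} (hF : F ≠ 0) (hFt : F ∈ PD k t)
    (hFM : ∀ j, F ∈ mx (q j) ^ M) : M * ∑ j, (w j) ^ 2 ≤ t * e ^ 2 := by
  have main : ∀ N : ℕ, t ≤ N → ((M : ℤ) * ∑ j, (w j : ℤ) ^ 2) * (N + 1) ^ 2 - 2 * M ^ 2 * (∑ j, (w j : ℤ)) * (N + 1)
      ≤ t * (e * (N + 1) + 2) ^ 2 := by
    intro N hN
    have hN' : t ≤ e * (N + 1) := by nlinarith
    obtain ⟨E', hE'⟩ := Nat.exists_eq_add_of_le hN'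
    have h1 := volume_ineq (IndS_mul h N) hF hFt hFM hE'
    have h2 : 6 * (∑ j, (lowf (w j * (N + 1) + 1)).card + (lowf (E' + 1)).card) ≤
      6 * ((lowf (e * (N + 1) + 1)).card + ∑ j, (lowf (w j * (N + 1) + 1 - M)).card) :=
        Nat.mul_le_mul_left 6 h1
    rw [mul_add, mul_add, Finset.mul_sum, Finset.mul_sum] at h2
    simp only [card_lowf] at h2
    have h3 : ∀ j, 3 * ((M : ℤ) * (w j : ℤ) ^ 2 * (N + 1) ^ 2 - 2 * M ^ 2 * w j * (N + 1)) ≤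
        (((w j * (N + 1) + 1) * (w j * (N + 1) + 1 + 1) * (w j * (N + 1) + 1 + 2) : ℕ) : ℤ) -
        (((w j * (N + 1) + 1 - M) * (w j * (N + 1) + 1 - M + 1) * (w j * (N + 1) + 1 - M + 2) : ℕ) : ℤ) := by
      intro j
      have gen : ∀ a b : ℤ, 0 ≤ b → ∀ M : ℤ, 0 ≤ M → a + 1 = b + M →
        3 * (M * a ^ 2 - 2 * M ^ 2 * a) ≤ (a + 1) * (a + 1 + 1) * (a + 1 + 2) - b * (b + 1) * (b + 2) := by
        intro a b hb M hM hab
        obtain rfl : a = b + M - 1 := by linarith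
        have hMM : M ≤ M * M := by
          rcases eq_or_lt_of_le hM with h | h
          · simp [← h]
          · nlinarith
        nlinarith [mul_nonneg hb hM, mul_nonneg (mul_nonneg hb hM) hM, mul_nonneg hM (mul_nonneg hM hM)]
      by_cases hc : M ≤ w j * (N + 1) + 1
      · obtain ⟨b, hb⟩ := Nat.exists_eq_add_of_le hc
        rw [show w j * (N + 1) + 1 - M = b by omega]
        have hb' : ((w j : ℤ) * (N + 1)) + 1 = b + M := by exact_mod_cast (by omega)
        have := gen ((w j : ℤ) * (N + 1)) b (by positivity) M (by positivity) hb'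
        push_cast
        nlinarith [this]
      · rw [show w j * (N + 1) + 1 - M = 0 by omega]
        push_cast
        have hc' : (w j : ℤ) * (N + 1) + 1 < M := by exact_mod_cast (by omega)
        have hp : (0:ℤ) ≤ (w j : ℤ) * (N + 1) := by positivity
        have : (M : ℤ) * (w j : ℤ) ^ 2 * (N + 1) ^ 2 - 2 * M ^ 2 * w j * (N + 1) =
          M * ((w j : ℤ) * (N + 1)) * ((w j : ℤ) * (N + 1) - 2 * M) := by ring
        rw [this]
        have h5 : M * ((w j : ℤ) * (N + 1)) * ((w j : ℤ) * (N + 1) - 2 * M) ≤ 0 :=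
          mul_nonpos_of_nonneg_of_nonpos (by positivity) (by linarith)
        have h6 : (0:ℤ) ≤ (w j * (N + 1) + 1) * (w j * (N + 1) + 1 + 1) * (w j * (N + 1) + 1 + 2) := by positivity
        linarith
    have h4 := Finset.sum_le_sum (fun j (_ : j ∈ Finset.univ) => h3 j)
    rw [Finset.sum_sub_distrib, ← Finset.mul_sum, Finset.sum_sub_distrib] at h4
    have h2' : ((∑ j, (w j * (N + 1) + 1) * (w j * (N + 1) + 1 + 1) * (w j * (N + 1) + 1 + 2) : ℕ) : ℤ)
       + (((E' + 1) * (E' + 1 + 1) * (E' + 1 + 2) : ℕ) : ℤ) ≤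
       (((e * (N + 1) + 1) * (e * (N + 1) + 1 + 1) * (e * (N + 1) + 1 + 2) : ℕ) : ℤ) +
       ((∑ j, (w j * (N + 1) + 1 - M) * (w j * (N + 1) + 1 - M + 1) * (w j * (N + 1) + 1 - M + 2) : ℕ) : ℤ) := by
      exact_mod_cast h2
    rw [Nat.cast_sum, Nat.cast_sum] at h2'
    have h7 : (((e * (N + 1) + 1) * (e * (N + 1) + 1 + 1) * (e * (N + 1) + 1 + 2) : ℕ) : ℤ) -
        (((E' + 1) * (E' + 1 + 1) * (E' + 1 + 2) : ℕ) : ℤ) ≤ 3 * (t * (e * (N + 1) + 2) ^ 2) := by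
      rw [hE']
      have : ((e : ℤ) * (N + 1)) = t + E' := by exact_mod_cast hE'
      rw [this]
      push_cast
      have p1 : (0:ℤ) ≤ t := by positivity
      have p2 : (0:ℤ) ≤ E' := by positivity
      nlinarith [mul_nonneg p1 p2, mul_nonneg p1 p1, mul_nonneg p1 (mul_nonneg p1 p1), mul_nonneg p1 (mul_nonneg p1 p2), mul_nonneg p1 (mul_nonneg p2 p2)]
    have e1 : ∑ j, (M : ℤ) * (w j : ℤ) ^ 2 * (N + 1) ^ 2 = ((M : ℤ) * ∑ j, (w j : ℤ) ^ 2) * (N + 1) ^ 2 := by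
      rw [Finset.mul_sum, Finset.sum_mul]
    have e2 : ∑ j, 2 * (M : ℤ) ^ 2 * w j * (N + 1) = 2 * M ^ 2 * (∑ j, (w j : ℤ)) * (N + 1) := by
      rw [Finset.mul_sum, Finset.sum_mul]
    rw [e1, e2] at h4
    linarith
  by_contra hcon
  push Not at hcon
  have hcon' : (t : ℤ) * e ^ 2 + 1 ≤ (M : ℤ) * ∑ j, (w j : ℤ) ^ 2 := by exact_mod_cast hcon
  set S := (M : ℤ) * ∑ j, (w j : ℤ) ^ 2 with hS
  set S1 := ∑ j, w j with hS1
  have hS1' : (∑ j, (w j : ℤ)) = (S1 : ℤ) := by simp [hS1]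
  have := main (2 * M ^ 2 * S1 + 4 * t * e + 4 * t + t) (by omega)
  rw [hS1'] at this
  set N : ℕ := 2 * M ^ 2 * S1 + 4 * t * e + 4 * t + t with hN
  have hN' : (N : ℤ) = 2 * M ^ 2 * S1 + 4 * t * e + 4 * t + t := by exact_mod_cast hN
  have hNN : (0:ℤ) ≤ N := by positivity
  have h8 : ((t : ℤ) * e ^ 2 + 1) * (N + 1) ^ 2 ≤ S * (N + 1) ^ 2 := by
    exact mul_le_mul_of_nonneg_right hcon' (by positivity)
  have h9 : (0:ℤ) ≤ t := by positivity
  have h10 : ((N : ℤ) + 1) * (N + 1) ≤ (2 * M ^ 2 * S1 + 4 * t * e) * (N + 1) + 4 * t := by nlinarith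
  have h11 : (2 * (M:ℤ) ^ 2 * S1 + 4 * t * e) = N - 5 * t := by linarith
  rw [h11] at h10
  nlinarith [mul_nonneg h9 hNN]

end FP

namespace FP
variable {k : Type*} [Field k]

/-- sections of degree `e` with the prescribed multiplicities -/
def Sec {n : ℕ} (q : Fin n → Fin 3 → k) (e : ℕ) (w : Fin n → ℕ) : Set (A3 k) :=
  {f | f ∈ PD k e ∧ ∀ i, f ∈ mx (q i) ^ (w i)}

lemma sec_up {n : ℕ} {q : Fin n → Fin 3 → k} {e : ℕ} {w : Fin n → ℕ} {D : ℕ} {j : Fin n}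
    (hw : w j ≤ D)
    (h : mx (q j) ^ D ≤ Ideal.span (Sec q e w) * mx (q j) ^ (D - w j) ⊔ mx (q j) ^ (D + 1)) (c : ℕ) :
    mx (q j) ^ (D + c) ≤
      Ideal.span (Sec q e w) * mx (q j) ^ (D + c - w j) ⊔ mx (q j) ^ (D + c + 1) := by
  calc mx (q j) ^ (D + c) = mx (q j) ^ D * mx (q j) ^ c := pow_add _ _ _
    _ ≤ (Ideal.span (Sec q e w) * mx (q j) ^ (D - w j) ⊔ mx (q j) ^ (D + 1)) * mx (q j) ^ c :=
      Ideal.mul_mono_left h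
    _ = _ := by
      rw [Ideal.sup_mul, mul_assoc, ← pow_add, ← pow_add, show D - w j + c = D + c - w j by omega,
        show D + 1 + c = D + c + 1 by omega]

lemma exists_sep {n : ℕ} {q : Fin n → Fin 3 → k} (hq : Function.Injective q) (c : ℕ) :
    ∃ C, ∀ j, ∃ f ∈ PD k C, f - 1 ∈ mx (q j) ∧ ∀ i, i ≠ j → f ∈ mx (q i) ^ c := by
  refine ⟨∑ i : Fin n, c * 1, fun j => ?_⟩
  have h1 : ∀ i, ∃ g ∈ PD k 1, eval (q j) g = 1 ∧ (i ≠ j → g ∈ mx (q i)) := by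
    intro i
    by_cases hij : i = j
    · exact ⟨1, one_mem_PD _, by simp, fun h => absurd hij h⟩
    · obtain ⟨a, ha⟩ : ∃ a, q i a ≠ q j a := by
        by_contra hc
        push Not at hc
        exact hij (hq (funext hc))
      refine ⟨C (q j a - q i a)⁻¹ * (X a - C (q i a)), ?_, ?_, fun _ => ?_⟩
      · have := PD_mul (C_mem_PD (q j a - q i a)⁻¹ 0) (lin_mem_PD a (q i a))
        simpa using this
      · simp only [map_mul, eval_C, map_sub, eval_X]
        exact inv_mul_cancel₀ (sub_ne_zero.2 ha.symm)
      · exact Ideal.mul_mem_left _ _ (Ideal.subset_span ⟨a, rfl⟩)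
  choose g hg1 hg2 hg3 using h1
  refine ⟨∏ i, g i ^ c, PD_prod _ _ _ fun i _ => PD_pow (hg1 i) c, ?_, fun i hi => ?_⟩
  · rw [mem_mx_one]
    simp [map_prod, hg2]
  · rw [← Finset.mul_prod_erase _ _ (Finset.mem_univ i)]
    exact Ideal.mul_mem_right _ _ (Ideal.pow_mem_pow (hg3 i hi) c)

lemma kappa {n : ℕ} {q : Fin n → Fin 3 → k} {e : ℕ} {w : Fin n → ℕ} {D : ℕ} {j : Fin n}
    (hw : w j ≤ D)
    (h : mx (q j) ^ D ≤ Ideal.span (Sec q e w) * mx (q j) ^ (D - w j) ⊔ mx (q j) ^ (D + 1))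
    (κ : ℕ) : ∀ c, ∀ r ∈ mx (q j) ^ (κ * w j + D + c), ∃ g ∈ PD k (e * κ + D + c),
      (∀ i, g ∈ mx (q i) ^ (w i * κ)) ∧ r - g ∈ mx (q j) ^ (κ * w j + D + c + 1) := by
  induction κ with
  | zero =>
    intro c r hr
    obtain ⟨g, h1, h2⟩ := taylor (q j) (D + c) r
    refine ⟨g, by simpa using h1, fun i => by simp, ?_⟩
    simpa using h2
  | succ κ ih =>
    intro c r hr
    have h1 := sec_up hw h (w j * (κ + 1) + c)
    rw [show (κ + 1) * w j + D + c = D + (w j * (κ + 1) + c) by ring] at *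
    have h2 := h1 hr
    rw [show D + (w j * (κ + 1) + c) - w j = κ * w j + D + c by
      have : D + (w j * (κ + 1) + c) = κ * w j + D + c + w j := by ring
      omega] at h2
    obtain ⟨y, hy, z, hz, rfl⟩ := Submodule.mem_sup.1 h2
    have h3 : ∃ g ∈ PD k (e * (κ + 1) + D + c),
      (∀ i, g ∈ mx (q i) ^ (w i * (κ + 1))) ∧ y - g ∈ mx (q j) ^ (D + (w j * (κ + 1) + c) + 1) := by
      clear h2 hr
      induction hy using Submodule.mul_induction_on' with
      | mem_mul_mem a ha b hb =>
        induction ha using Submodule.span_induction generalizing b with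
        | mem a ha =>
          obtain ⟨g, g1, g2, g3⟩ := ih c b hb
          refine ⟨a * g, ?_, fun i => ?_, ?_⟩
          · exact PD_mono (by ring_nf; rfl) (PD_mul ha.1 g1)
          · exact mul_mem_mx (ha.2 i) (g2 i) (by ring_nf; rfl)
          · rw [← mul_sub]
            exact mul_mem_mx (ha.2 j) g3 (by ring_nf; rfl)
        | zero => exact ⟨0, Submodule.zero_mem _, fun _ => Ideal.zero_mem _, by simp⟩
        | add x y hx hy ihx ihy =>
          obtain ⟨g1, u1, u2, u3⟩ := ihx b hb
          obtain ⟨g2, v1, v2, v3⟩ := ihy b hb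
          refine ⟨g1 + g2, Submodule.add_mem _ u1 v1, fun i => Ideal.add_mem _ (u2 i) (v2 i), ?_⟩
          have : (x + y) * b - (g1 + g2) = (x * b - g1) + (y * b - g2) := by ring
          rw [this]
          exact Ideal.add_mem _ u3 v3
        | smul a x hx ihx =>
          obtain ⟨g1, u1, u2, u3⟩ := ihx (a * b) (Ideal.mul_mem_left _ _ hb)
          refine ⟨g1, u1, u2, ?_⟩
          convert u3 using 1
          simp only [smul_eq_mul]; ring
      | add x hx y hy ihx ihy =>
        obtain ⟨g1, u1, u2, u3⟩ := ihx
        obtain ⟨g2, v1, v2, v3⟩ := ihy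
        refine ⟨g1 + g2, Submodule.add_mem _ u1 v1, fun i => Ideal.add_mem _ (u2 i) (v2 i), ?_⟩
        have : x + y - (g1 + g2) = (x - g1) + (y - g2) := by ring
        rw [this]
        exact Ideal.add_mem _ u3 v3
    obtain ⟨g, g1, g2, g3⟩ := h3
    refine ⟨g, g1, g2, ?_⟩
    have : y + z - g = (y - g) + z := by ring
    rw [this]
    exact Ideal.add_mem _ g3 hz

lemma mul_sep {q : Fin 3 → k} {b : ℕ} {r g f : A3 k} (hr : r ∈ mx q ^ b) (hg : r - g ∈ mx q ^ (b + 1))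
    (hf : f - 1 ∈ mx q) : r - g * f ∈ mx q ^ (b + 1) := by
  have hgb : g ∈ mx q ^ b := by
    have := Ideal.sub_mem _ hr (mx_pow_anti _ (Nat.le_succ b) hg)
    simpa using this
  have : r - g * f = (r - g) - g * (f - 1) := by ring
  rw [this]
  refine Ideal.sub_mem _ hg ?_
  rw [pow_succ]
  exact Ideal.mul_mem_mul hgb hf

lemma IndS_config {n : ℕ} {q : Fin n → Fin 3 → k} (hq : Function.Injective q) {e : ℕ}
    {w : Fin n → ℕ} {D : ℕ} (hw : ∀ j, w j ≤ D)
    (h : ∀ j, mx (q j) ^ D ≤ Ideal.span (Sec q e w) * mx (q j) ^ (D - w j) ⊔ mx (q j) ^ (D + 1)) :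
    ∃ C, ∀ κ, IndS q (e * κ + C) (fun j => w j * κ + D) := by
  obtain ⟨C1, hC1⟩ := exists_sep hq (∑ i, w i + D)
  have hle : ∀ i, w i ≤ ∑ i, w i := fun i => Finset.single_le_sum (fun _ _ => Nat.zero_le _) (Finset.mem_univ i)
  refine ⟨D + ∑ i, w i + C1, fun κ => ?_⟩
  induction κ with
  | zero =>
    refine IndS_step (E := 0) (m := 0) (Nat.zero_le _) (fun j => Nat.zero_le _) ?_ ?_
    · intro v
      exact ⟨0, Submodule.zero_mem _, fun j => by simp⟩
    · intro j b _ hb r hr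
      simp only [mul_zero, zero_add] at hb ⊢
      obtain ⟨g, g1, g2⟩ := taylor (q j) b r
      obtain ⟨f, f1, f2, f3⟩ := hC1 j
      refine ⟨g * f, PD_mono (by omega) (PD_mul g1 f1), fun i hi => ?_, mul_sep hr g2 f2⟩
      exact Ideal.mul_mem_left _ _ (mx_pow_anti _ (by omega) (f3 i hi))
  | succ κ ih =>
    refine IndS_step ?_ ?_ ih ?_
    · have : e * (κ + 1) = e * κ + e := by ring
      omega
    · intro j
      have : w j * (κ + 1) = w j * κ + w j := by ring
      simp only [this]
      omega
    · intro j b hb1 hb2 r hr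
      obtain ⟨c, rfl⟩ := Nat.exists_eq_add_of_le hb1
      replace hb2 : w j * κ + D + c < w j * (κ + 1) + D := hb2
      replace hr : r ∈ mx (q j) ^ (w j * κ + D + c) := hr
      change ∃ g ∈ PD k _, (∀ i, i ≠ j → g ∈ mx (q i) ^ (w i * (κ + 1) + D)) ∧ r - g ∈ mx (q j) ^ (w j * κ + D + c + 1)
      have hc : c ≤ w j := by
        have : w j * (κ + 1) = w j * κ + w j := by ring
        omega
      have e1 : w j * κ + D + c = κ * w j + D + c := by ring
      rw [e1] at hr ⊢
      obtain ⟨g, g1, g2, g3⟩ := kappa (hw j) (h j) κ c r hr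
      obtain ⟨f, f1, f2, f3⟩ := hC1 j
      refine ⟨g * f, PD_mono ?_ (PD_mul g1 f1), fun i hi => ?_, mul_sep hr g3 f2⟩
      · have : e * (κ + 1) = e * κ + e := by ring
        have := hle j
        omega
      · refine mul_mem_mx (g2 i) (f3 i hi) ?_
        have : w i * (κ + 1) = w i * κ + w i := by ring
        have := hle i
        omega

lemma vol_generic {n : ℕ} {q : Fin n → Fin 3 → k} (hq : Function.Injective q) {e s : ℕ} (he : 1 ≤ e)
    {w : Fin n → ℕ} {D : ℕ} (hD : 1 ≤ D) (hw : ∀ j, w j ≤ D)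
    (h : ∀ j, mx (q j) ^ D ≤ Ideal.span (Sec q e w) * mx (q j) ^ (D - w j) ⊔ mx (q j) ^ (D + 1))
    (hs : s * e ^ 2 < 3 * ∑ j, (w j) ^ 2) :
    GenA k n (fun q => ∀ t M : ℕ, ∀ F : A3 k, F ≠ 0 → F ∈ PD k t → (∀ j, F ∈ mx (q j) ^ M) → s * M ≤ 3 * t) := by
  obtain ⟨C, hC⟩ := IndS_config hq hw h
  set κ := s * (2 * e * C + C ^ 2) + 1 with hκ
  refine (GenA_IndS (hC κ)).mono fun q' hq' t M F hF hFt hFM => ?_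
  have h1 : IndS q' (e * κ + C) (fun j => w j * κ + 1) := by
    intro v
    obtain ⟨g, g1, g2⟩ := hq' v
    exact ⟨g, g1, fun j => mx_pow_anti _ (by simp only; omega) (g2 j)⟩
  have hpos : 1 ≤ e * κ + C := by
    have : 1 ≤ e * κ := Nat.mul_pos he (by omega)
    omega
  have h2 := volume_bound (w := fun j => w j * κ) hpos h1 hF hFt hFM
  have h3 : ∑ j, (w j * κ) ^ 2 = (∑ j, (w j) ^ 2) * κ ^ 2 := by
    rw [Finset.sum_mul]; refine Finset.sum_congr rfl fun j _ => by ring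
  rw [h3] at h2
  have h4 : s * (e * κ + C) ^ 2 ≤ 3 * (∑ j, (w j) ^ 2) * κ ^ 2 := by
    have : (s * e ^ 2 + 1) * κ ^ 2 ≤ 3 * (∑ j, (w j) ^ 2) * κ ^ 2 := Nat.mul_le_mul_right _ hs
    have hk : s * (2 * e * C * κ + C ^ 2) ≤ κ ^ 2 := by
      have h1k : 1 ≤ κ := by omega
      calc s * (2 * e * C * κ + C ^ 2) ≤ s * (2 * e * C * κ + C ^ 2 * κ) := by gcongr; nlinarith
        _ = (s * (2 * e * C + C ^ 2)) * κ := by ring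
        _ ≤ κ * κ := by gcongr; omega
        _ = κ ^ 2 := by ring
    nlinarith
  have h5 : (s * M) * (e * κ + C) ^ 2 ≤ (3 * t) * (e * κ + C) ^ 2 := by
    calc (s * M) * (e * κ + C) ^ 2 = M * (s * (e * κ + C) ^ 2) := by ring
      _ ≤ M * (3 * (∑ j, (w j) ^ 2) * κ ^ 2) := by gcongr
      _ = 3 * (M * ((∑ j, (w j) ^ 2) * κ ^ 2)) := by ring
      _ ≤ 3 * (t * (e * κ + C) ^ 2) := by gcongr
      _ = _ := by ring
  exact Nat.le_of_mul_le_mul_right h5 (by positivity)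

end FP

namespace FP
variable {k : Type*} [Field k]

/-- abscissae of six plane points -/
def ptx : Fin 6 → ℤ := ![-1, -1, 0, 0, 1, 2]
/-- ordinates of six plane points -/
def pty : Fin 6 → ℤ := ![-1, 0, -1, 1, 1, 0]
/-- conics through five of the six points -/
def cf : Fin 6 → Fin 6 → ℤ := ![![-1, 0, -2, 1, 0, 2], ![-1, 1, -4, 0, 0, 4], ![-1, 0, -1, 1, -1, 2],
  ![-1, 2, -3, 1, -1, 2], ![-1, 2, -2, 1, 0, 2], ![-1, 1, -1, 0, 0, 1]]

/-- the conic missing point `i` -/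
noncomputable def Con (k : Type*) [Field k] (i : Fin 6) : A3 k :=
  (cf i 0 : A3 k) * X 0 ^ 2 + (cf i 1 : A3 k) * (X 0 * X 1) + (cf i 2 : A3 k) * X 1 ^ 2
    + (cf i 3 : A3 k) * X 0 + (cf i 4 : A3 k) * X 1 + (cf i 5 : A3 k)

/-- the line through points `i` and `j` -/
noncomputable def Lin (k : Type*) [Field k] (i j : Fin 6) : A3 k :=
  ((pty j - pty i : ℤ) : A3 k) * (X 0 - (ptx i : A3 k)) -
    ((ptx j - ptx i : ℤ) : A3 k) * (X 1 - (pty i : A3 k))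

/-- integer value of the conic -/
def conZ (i s : Fin 6) : ℤ := cf i 0 * ptx s ^ 2 + cf i 1 * (ptx s * pty s) + cf i 2 * pty s ^ 2
    + cf i 3 * ptx s + cf i 4 * pty s + cf i 5

/-- integer value of the line -/
def linZ (i j s : Fin 6) : ℤ := (pty j - pty i) * (ptx s - ptx i) - (ptx j - ptx i) * (pty s - pty i)

lemma conZ_zero : ∀ i s : Fin 6, i ≠ s → conZ i s = 0 := by decide
lemma conZ_ne : ∀ i : Fin 6, conZ i i ≠ 0 := by decide
lemma linZ_zero : ∀ i j : Fin 6, linZ i j i = 0 ∧ linZ i j j = 0 := by decide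
lemma linZ_ne : ∀ i j s : Fin 6, i ≠ j → s ≠ i → s ≠ j → linZ i j s ≠ 0 := by decide

lemma unit_mem [CharZero k] {J : Ideal (A3 k)} {d : ℤ} (hd : d ≠ 0) {f : A3 k} (h : (d : A3 k) * f ∈ J) :
    f ∈ J := by
  have hd' : (d : k) ≠ 0 := by exact_mod_cast hd
  have h2 := J.mul_mem_left (C (d : k)⁻¹) h
  rwa [← mul_assoc, show (d : A3 k) = C (d : k) by simp, ← C_mul, inv_mul_cancel₀ hd', C_1, one_mul] at h2

lemma quad_aux [CharZero k] {J : Ideal (A3 k)} {d : ℤ} (hd : d ≠ 0) (l1 l2 l3 r0 r1 r2 r3 : A3 k)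
    {f g1 g2 g3 c30 c21 c12 c03 : A3 k} (h1 : g1 ∈ J) (h2 : g2 ∈ J) (h3 : g3 ∈ J)
    (h30 : c30 ∈ J) (h21 : c21 ∈ J) (h12 : c12 ∈ J) (h03 : c03 ∈ J)
    (h : (d : A3 k) * f = l1 * g1 + l2 * g2 + l3 * g3 + (r0 * c30 + r1 * c21 + r2 * c12 + r3 * c03)) :
    f ∈ J := by
  refine unit_mem hd (h ▸ ?_)
  refine Ideal.add_mem _ (Ideal.add_mem _ (Ideal.add_mem _ ?_ ?_) ?_)
    (Ideal.add_mem _ (Ideal.add_mem _ (Ideal.add_mem _ ?_ ?_) ?_) ?_) <;>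
  exact Ideal.mul_mem_left _ _ (by assumption)

lemma quadmem [CharZero k] (s : Fin 6) (J : Ideal (A3 k)) (x y : A3 k) (hx : x = X 0 - (ptx s : A3 k))
    (hy : y = X 1 - (pty s : A3 k)) (hG : ∀ a, a ≠ s → Con k a * Lin k s a ∈ J)
    (hCC : ∀ a b, a ≠ s → b ≠ s → a ≠ b → Con k a * Con k b ∈ J)
    (h30 : x ^ 3 ∈ J) (h21 : x ^ 2 * y ∈ J) (h12 : x * y ^ 2 ∈ J) (h03 : y ^ 3 ∈ J) :
    x ^ 2 ∈ J ∧ x * y ∈ J ∧ y ^ 2 ∈ J := by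
  fin_cases s
  · -- point 0
    have g1 := hG 1 (by decide)
    have g2 := hG 2 (by decide)
    have g3 := hCC 1 2 (by decide) (by decide) (by decide)
    refine ⟨?_, ?_, ?_⟩
    · refine quad_aux (d := 20) (by norm_num) (-1) (49) (7) ((27) + (-7) * x ^ 1 + (7) * y ^ 1) ((-13) + (-35) * y ^ 1) ((80) + (7) * y ^ 1) ((28) + (-28) * y ^ 1) g1 g2 g3 h30 h21 h12 h03 ?_
      subst hx hy; simp [Con, Lin, cf, ptx, pty]; ring
    · refine quad_aux (d := 20) (by norm_num) (3) (-7) (-1) ((-1) + (1) * x ^ 1 + (-1) * y ^ 1) ((-1) + (5) * y ^ 1) ((-1) * y ^ 1) ((-4) + (4) * y ^ 1) g1 g2 g3 h30 h21 h12 h03 ?_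
      subst hx hy; simp [Con, Lin, cf, ptx, pty]; ring
    · refine quad_aux (d := 20) (by norm_num) (-9) (1) (3) ((3) + (-3) * x ^ 1 + (3) * y ^ 1) ((23) + (-15) * y ^ 1) ((3) * y ^ 1) ((32) + (-12) * y ^ 1) g1 g2 g3 h30 h21 h12 h03 ?_
      subst hx hy; simp [Con, Lin, cf, ptx, pty]; ring
  · -- point 1
    have g1 := hG 0 (by decide)
    have g2 := hG 2 (by decide)
    have g3 := hCC 0 2 (by decide) (by decide) (by decide)
    refine ⟨?_, ?_, ?_⟩
    · refine quad_aux (d := 3) (by norm_num) (-1) (0) (0) ((1)) (0) ((2)) (0) g1 g2 g3 h30 h21 h12 h03 ?_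
      subst hx hy; simp [Con, Lin, cf, ptx, pty]; ring
    · refine quad_aux (d := 3) (by norm_num) (-3) (0) (-1) ((-3) + (1) * x ^ 1) ((1) + (3) * y ^ 1) ((-3)) ((2) + (2) * y ^ 1) g1 g2 g3 h30 h21 h12 h03 ?_
      subst hx hy; simp [Con, Lin, cf, ptx, pty]; ring
    · refine quad_aux (d := 3) (by norm_num) (-9) (3) (-2) ((-6) + (2) * x ^ 1) ((-1) + (6) * y ^ 1) ((-3)) ((1) + (4) * y ^ 1) g1 g2 g3 h30 h21 h12 h03 ?_
      subst hx hy; simp [Con, Lin, cf, ptx, pty]; ring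
  · -- point 2
    have g1 := hG 4 (by decide)
    have g2 := hG 5 (by decide)
    have g3 := hCC 4 5 (by decide) (by decide) (by decide)
    refine ⟨?_, ?_, ?_⟩
    · refine quad_aux (d := 3) (by norm_num) (2) (-12) (-5) ((2) + (5) * x ^ 1 + (-15) * y ^ 1) ((-19) + (25) * y ^ 1) ((31) + (-20) * y ^ 1) ((-20) + (10) * y ^ 1) g1 g2 g3 h30 h21 h12 h03 ?_
      subst hx hy; simp [Con, Lin, cf, ptx, pty]; ring
    · refine quad_aux (d := 3) (by norm_num) (1) (-3) (-1) ((1) + (1) * x ^ 1 + (-3) * y ^ 1) ((-5) + (5) * y ^ 1) ((8) + (-4) * y ^ 1) ((-4) + (2) * y ^ 1) g1 g2 g3 h30 h21 h12 h03 ?_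
      subst hx hy; simp [Con, Lin, cf, ptx, pty]; ring
    · refine quad_aux (d := 12) (by norm_num) (2) (-3) (1) ((-1) + (-1) * x ^ 1 + (3) * y ^ 1) ((8) + (-5) * y ^ 1) ((-8) + (4) * y ^ 1) ((10) + (-2) * y ^ 1) g1 g2 g3 h30 h21 h12 h03 ?_
      subst hx hy; simp [Con, Lin, cf, ptx, pty]; ring
  · -- point 3
    have g1 := hG 1 (by decide)
    have g2 := hG 4 (by decide)
    have g3 := hCC 1 4 (by decide) (by decide) (by decide)
    refine ⟨?_, ?_, ?_⟩
    · refine quad_aux (d := 5) (by norm_num) (4) (-16) (3) ((8) + (-3) * x ^ 1 + (9) * y ^ 1) ((-27) + (-24) * y ^ 1) ((50) + (30) * y ^ 1) ((-48) + (-24) * y ^ 1) g1 g2 g3 h30 h21 h12 h03 ?_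
      subst hx hy; simp [Con, Lin, cf, ptx, pty]; ring
    · refine quad_aux (d := 5) (by norm_num) (3) (-2) (1) ((1) + (-1) * x ^ 1 + (3) * y ^ 1) ((-9) + (-8) * y ^ 1) ((15) + (10) * y ^ 1) ((-16) + (-8) * y ^ 1) g1 g2 g3 h30 h21 h12 h03 ?_
      subst hx hy; simp [Con, Lin, cf, ptx, pty]; ring
    · refine quad_aux (d := 20) (by norm_num) (9) (-1) (3) ((3) + (-3) * x ^ 1 + (9) * y ^ 1) ((-32) + (-24) * y ^ 1) ((55) + (30) * y ^ 1) ((-58) + (-24) * y ^ 1) g1 g2 g3 h30 h21 h12 h03 ?_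
      subst hx hy; simp [Con, Lin, cf, ptx, pty]; ring
  · -- point 4
    have g1 := hG 2 (by decide)
    have g2 := hG 5 (by decide)
    have g3 := hCC 2 5 (by decide) (by decide) (by decide)
    refine ⟨?_, ?_, ?_⟩
    · refine quad_aux (d := 12) (by norm_num) (-2) (27) (-11) ((-1) + (11) * x ^ 1 + (-11) * y ^ 1) ((31) + (22) * y ^ 1) ((-7) + (-11) * y ^ 1) ((15) + (11) * y ^ 1) g1 g2 g3 h30 h21 h12 h03 ?_
      subst hx hy; simp [Con, Lin, cf, ptx, pty]; ring
    · refine quad_aux (d := 12) (by norm_num) (2) (-9) (5) ((-5) + (-5) * x ^ 1 + (5) * y ^ 1) ((-13) + (-10) * y ^ 1) ((1) + (5) * y ^ 1) ((-9) + (-5) * y ^ 1) g1 g2 g3 h30 h21 h12 h03 ?_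
      subst hx hy; simp [Con, Lin, cf, ptx, pty]; ring
    · refine quad_aux (d := 12) (by norm_num) (-2) (3) (1) ((-1) + (-1) * x ^ 1 + (1) * y ^ 1) ((-5) + (-2) * y ^ 1) ((5) + (1) * y ^ 1) ((-9) + (-1) * y ^ 1) g1 g2 g3 h30 h21 h12 h03 ?_
      subst hx hy; simp [Con, Lin, cf, ptx, pty]; ring
  · -- point 5
    have g1 := hG 2 (by decide)
    have g2 := hG 4 (by decide)
    have g3 := hCC 2 4 (by decide) (by decide) (by decide)
    refine ⟨?_, ?_, ?_⟩
    · refine quad_aux (d := 30) (by norm_num) (-16) (1) (9) ((-37) + (-9) * x ^ 1 + (18) * y ^ 1) ((48) + (-27) * y ^ 1) ((-47) + (18) * y ^ 1) ((-12) + (-18) * y ^ 1) g1 g2 g3 h30 h21 h12 h03 ?_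
      subst hx hy; simp [Con, Lin, cf, ptx, pty]; ring
    · refine quad_aux (d := 10) (by norm_num) (-4) (-1) (1) ((-3) + (-1) * x ^ 1 + (2) * y ^ 1) ((2) + (-3) * y ^ 1) ((-3) + (2) * y ^ 1) ((-8) + (-2) * y ^ 1) g1 g2 g3 h30 h21 h12 h03 ?_
      subst hx hy; simp [Con, Lin, cf, ptx, pty]; ring
    · refine quad_aux (d := 10) (by norm_num) (-3) (3) (2) ((-6) + (-2) * x ^ 1 + (4) * y ^ 1) ((9) + (-6) * y ^ 1) ((-11) + (4) * y ^ 1) ((4) + (-4) * y ^ 1) g1 g2 g3 h30 h21 h12 h03 ?_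
      subst hx hy; simp [Con, Lin, cf, ptx, pty]; ring

end FP

namespace FP
variable {k : Type*} [Field k]

/-- The volume inequality as a predicate on configurations. -/
def Vol {n : ℕ} (s : ℕ) (q : Fin n → Fin 3 → k) : Prop :=
  ∀ t M : ℕ, ∀ F : A3 k, F ≠ 0 → F ∈ PD k t → (∀ j, F ∈ mx (q j) ^ M) → s * M ≤ 3 * t

lemma cof {q : Fin 3 → k} {a : ℕ} {J : Ideal (A3 k)} {f g : A3 k} (hf : eval q f ≠ 0)
    (hg : g ∈ mx q ^ a) (hJ : mx q ^ (a + 1) ≤ J) (h : f * g ∈ J) : g ∈ J := by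
  have h1 : f - C (eval q f) ∈ mx q := by rw [mem_mx_one]; simp
  have h2 : (f - C (eval q f)) * g ∈ J := by
    apply hJ
    rw [pow_succ']
    exact Ideal.mul_mem_mul h1 hg
  have h3 : C (eval q f) * g ∈ J := by
    have := J.sub_mem h h2
    rwa [sub_mul, sub_sub_cancel] at this
  have := J.mul_mem_left (C (eval q f)⁻¹) h3
  rwa [← mul_assoc, ← C_mul, inv_mul_cancel₀ hf, C_1, one_mul] at this

lemma lin_mx (q : Fin 3 → k) (i : Fin 3) : (X i - C (q i) : A3 k) ∈ mx q :=
  Ideal.subset_span ⟨i, rfl⟩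

lemma mx_le_of {q : Fin 3 → k} {J : Ideal (A3 k)} (h : ∀ i, (X i - C (q i) : A3 k) ∈ J) : mx q ≤ J := by
  rw [mx, Ideal.span_le]
  rintro _ ⟨i, rfl⟩
  exact h i

/-- grid points -/
def gridpt (k : Type*) [Field k] (g j : ℕ) : Fin 3 → k :=
  ![((j % g : ℕ) : k), ((j / g % g : ℕ) : k), ((j / (g * g) : ℕ) : k)]

lemma gridpt_inj [CharZero k] {g i j : ℕ} (h : gridpt k g i = gridpt k g j) : i = j := by
  have h0 := congrFun h 0
  have h1 := congrFun h 1
  have h2 := congrFun h 2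
  simp only [gridpt, Matrix.cons_val, Nat.cast_inj] at h0 h1 h2
  rw [← Nat.div_div_eq_div_mul, ← Nat.div_div_eq_div_mul] at h2
  rw [← Nat.div_add_mod i g, ← Nat.div_add_mod j g, h0, ← Nat.div_add_mod (i / g) g,
    ← Nat.div_add_mod (j / g) g, h1, h2]

lemma grid_vol [CharZero k] {n g s : ℕ} (hg : 1 ≤ g) (hn : n ≤ g ^ 3) (hs : s * g ^ 2 < 3 * n) :
    GenA k n (Vol s) := by
  have hc : ∀ (j : Fin n) (i : Fin 3), ∃ c < g, gridpt k g j i = (c : k) := by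
    intro j i
    have hj : (j : ℕ) < g * g * g := by have := j.2; nlinarith
    fin_cases i
    · exact ⟨_, Nat.mod_lt _ hg, rfl⟩
    · exact ⟨_, Nat.mod_lt _ hg, rfl⟩
    · exact ⟨_, Nat.div_lt_of_lt_mul hj, rfl⟩
  refine vol_generic (q := fun j : Fin n => gridpt k g j) (e := g) (w := fun _ => 1) (D := 1)
    (fun i j h => Fin.ext (gridpt_inj h)) hg le_rfl (fun _ => le_rfl) (fun j => ?_) (by simpa using hs)
  simp only [Nat.sub_self, pow_zero, pow_one, Ideal.one_eq_top, Ideal.mul_top]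
  refine mx_le_of fun i => ?_
  obtain ⟨c, hcg, hcj⟩ := hc j i
  refine cof (q := gridpt k g j) (a := 1) (f := ∏ c' ∈ (Finset.range g).erase c, (X i - C (c' : k))) ?_
    (by simpa using lin_mx _ i) le_sup_right (Ideal.mem_sup_left (Ideal.subset_span ?_))
  · rw [eval_prod, Finset.prod_ne_zero_iff]
    intro a ha
    simp only [map_sub, eval_X, eval_C, hcj]
    rw [sub_ne_zero]
    exact_mod_cast (Finset.ne_of_mem_erase ha).symm
  · rw [hcj, Finset.prod_erase_mul _ _ (Finset.mem_range.2 hcg)]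
    refine ⟨?_, fun j' => ?_⟩
    · have := PD_prod (k := k) (Finset.range g) (fun c' => X i - C (c' : k)) (fun _ => 1)
        (fun c' _ => lin_mem_PD i _)
      simpa using this
    · obtain ⟨c, hcg, hcj⟩ := hc j' i
      rw [pow_one, mem_mx_one, eval_prod]
      exact Finset.prod_eq_zero (Finset.mem_range.2 hcg) (by simp [hcj])

/-- a plane point lifted to height `z` -/
def pt6 (k : Type*) [Field k] (s : Fin 6) (z : ℕ) : Fin 3 → k := ![(ptx s : k), (pty s : k), (z : k)]

lemma eval_Con (s i : Fin 6) (z : ℕ) : eval (pt6 k s z) (Con k i) = (conZ i s : k) := by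
  simp [pt6, Con, conZ]

lemma eval_Lin (s i j : Fin 6) (z : ℕ) : eval (pt6 k s z) (Lin k i j) = (linZ i j s : k) := by
  simp [pt6, Lin, linZ]

lemma int_mem_PD (c : ℤ) (T : ℕ) : (c : A3 k) ∈ PD k T := by
  rw [show (c : A3 k) = C (c : k) by simp]
  exact C_mem_PD _ _

lemma Con_PD (i : Fin 6) : Con k i ∈ PD k 2 := by
  have hX : ∀ a : Fin 3, ∀ c : ℤ, (c : A3 k) * X a ∈ PD k 2 := fun a c =>
    PD_mono (by norm_num) (PD_mul (int_mem_PD c 0) (X_mem_PD a))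
  have hXX : ∀ a b : Fin 3, ∀ c : ℤ, (c : A3 k) * (X a * X b) ∈ PD k 2 := fun a b c =>
    PD_mono (by norm_num) (PD_mul (int_mem_PD c 0) (PD_mul (X_mem_PD a) (X_mem_PD b)))
  unfold Con
  rw [pow_two, pow_two]
  exact add_mem (add_mem (add_mem (add_mem (add_mem (hXX _ _ _) (hXX _ _ _)) (hXX _ _ _)) (hX _ _)) (hX _ _))
    (int_mem_PD _ _)

lemma Lin_PD (i j : Fin 6) : Lin k i j ∈ PD k 1 := by
  have h : ∀ a : Fin 3, ∀ c d : ℤ, (c : A3 k) * (X a - (d : A3 k)) ∈ PD k 1 := fun a c d =>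
    PD_mono (by norm_num) (PD_mul (int_mem_PD c 0) (sub_mem (X_mem_PD a) (int_mem_PD d 1)))
  unfold Lin
  exact sub_mem (h _ _ _) (h _ _ _)

lemma Con_mx {s i : Fin 6} (z : ℕ) (h : i ≠ s) : Con k i ∈ mx (pt6 k s z) := by
  rw [mem_mx_one, eval_Con, conZ_zero i s h]; simp

lemma Lin_mx_left (i j : Fin 6) (z : ℕ) : Lin k i j ∈ mx (pt6 k i z) := by
  rw [mem_mx_one, eval_Lin, (linZ_zero i j).1]; simp

lemma Lin_mx_right (i j : Fin 6) (z : ℕ) : Lin k i j ∈ mx (pt6 k j z) := by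
  rw [mem_mx_one, eval_Lin, (linZ_zero i j).2]; simp

lemma ConLin_mx (s i j : Fin 6) (z : ℕ) : Con k i * Lin k i j ∈ mx (pt6 k s z) := by
  by_cases h : i = s
  · subst h; exact Ideal.mul_mem_left _ _ (Lin_mx_left _ _ _)
  · exact Ideal.mul_mem_right _ _ (Con_mx z h)

lemma E_mx (s i j : Fin 6) (hij : i ≠ j) (z : ℕ) : Con k i * Con k j * Lin k i j ∈ mx (pt6 k s z) ^ 2 := by
  rw [pow_two]
  by_cases h : i = s
  · subst h
    rw [mul_assoc]
    exact Ideal.mul_mem_left _ _ (Ideal.mul_mem_mul (Con_mx z hij.symm) (Lin_mx_left _ _ _))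
  · by_cases h' : j = s
    · subst h'
      rw [mul_right_comm]
      exact Ideal.mul_mem_right _ _ (Ideal.mul_mem_mul (Con_mx z h) (Lin_mx_right _ _ _))
    · exact Ideal.mul_mem_right _ _ (Ideal.mul_mem_mul (Con_mx z h) (Con_mx z h'))

lemma X2_mx (s : Fin 6) (z : ℕ) : (X 2 - C (z : k) : A3 k) ∈ mx (pt6 k s z) := by
  simpa [pt6] using lin_mx (pt6 k s z) 2

/-- the plane index of a point of the 15-point configuration -/
def sidx (j : Fin 15) : Fin 6 := ⟨j % 6, Nat.mod_lt _ (by norm_num)⟩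

/-- the 15-point configuration -/
def q15 (k : Type*) [Field k] (j : Fin 15) : Fin 3 → k := pt6 k (sidx j) (j / 6)

/-- its weights -/
def w15 (j : Fin 15) : ℕ := if (j : ℕ) < 12 then 2 else 1

lemma w15_cases (j : Fin 15) :
    ((j : ℕ) / 6 = 0 ∧ w15 j = 2) ∨ ((j : ℕ) / 6 = 1 ∧ w15 j = 2) ∨ ((j : ℕ) / 6 = 2 ∧ w15 j = 1) := by
  revert j; decide

lemma pt_inj : ∀ s t : Fin 6, ptx s = ptx t → pty s = pty t → s = t := by decide

lemma q15_inj [CharZero k] : Function.Injective (q15 k) := by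
  intro i j h
  have h0 := congrFun h 0
  have h1 := congrFun h 1
  have h2 := congrFun h 2
  simp only [q15, pt6, Matrix.cons_val, Nat.cast_inj, Int.cast_inj] at h0 h1 h2
  have h3 := pt_inj _ _ h0 h1
  simp only [sidx, Fin.mk.injEq] at h3
  apply Fin.ext
  omega

lemma E_sec (i j : Fin 6) (hij : i ≠ j) : Con k i * Con k j * Lin k i j ∈ Sec (q15 k) 5 w15 := by
  refine ⟨PD_mul (PD_mul (Con_PD i) (Con_PD j)) (Lin_PD i j), fun l => ?_⟩
  refine mx_pow_anti _ ?_ (E_mx _ i j hij _)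
  rcases w15_cases l with h | h | h <;> omega

lemma B_sec (i j : Fin 6) :
    X 2 * (X 2 - C (1 : k)) * (Con k i * Lin k i j) ∈ Sec (q15 k) 5 w15 := by
  refine ⟨PD_mul (PD_mul (X_mem_PD 2) (lin_mem_PD 2 1)) (PD_mul (Con_PD i) (Lin_PD i j)), fun l => ?_⟩
  have hX := X2_mx (k := k) (sidx l) (l / 6)
  rcases w15_cases l with ⟨h, h'⟩ | ⟨h, h'⟩ | ⟨h, h'⟩ <;> rw [q15, h, h'] <;> rw [h] at hX
  · rw [pow_two]
    refine Ideal.mul_mem_mul (Ideal.mul_mem_right _ _ ?_) (ConLin_mx _ _ _ _)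
    simpa using hX
  · rw [pow_two]
    refine Ideal.mul_mem_mul (Ideal.mul_mem_left _ _ ?_) (ConLin_mx _ _ _ _)
    simpa using hX
  · rw [pow_one]
    exact Ideal.mul_mem_left _ _ (ConLin_mx _ _ _ _)

lemma Z_sec : (X 2 ^ 2 * (X 2 - C (1 : k)) ^ 2 * (X 2 - C (2 : k)) : A3 k) ∈ Sec (q15 k) 5 w15 := by
  refine ⟨PD_mul (PD_mul (PD_pow (X_mem_PD 2) 2) (PD_pow (lin_mem_PD 2 1) 2)) (lin_mem_PD 2 2), fun l => ?_⟩
  have hX := X2_mx (k := k) (sidx l) (l / 6)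
  rcases w15_cases l with ⟨h, h'⟩ | ⟨h, h'⟩ | ⟨h, h'⟩ <;> rw [q15, h, h'] <;> rw [h] at hX
  · refine Ideal.mul_mem_right _ _ (Ideal.mul_mem_right _ _ (Ideal.pow_mem_pow ?_ 2))
    simpa using hX
  · refine Ideal.mul_mem_right _ _ (Ideal.mul_mem_left _ _ (Ideal.pow_mem_pow ?_ 2))
    simpa using hX
  · rw [pow_one]
    refine Ideal.mul_mem_left _ _ ?_
    simpa using hX

end FP

namespace FP
variable {k : Type*} [Field k]

lemma cube_le {q : Fin 3 → k} {K : Ideal (A3 k)}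
    (h : ∀ a b c : Fin 3, (X a - C (q a)) * (X b - C (q b)) * (X c - C (q c)) ∈ K) : mx q ^ 3 ≤ K := by
  rw [pow_succ, pow_two, mx, Ideal.span_mul_span', Ideal.span_mul_span', Ideal.span_le]
  rintro _ ⟨_, ⟨_, ⟨a, rfl⟩, _, ⟨b, rfl⟩, rfl⟩, _, ⟨c, rfl⟩, rfl⟩
  exact h a b c

lemma cube_le_two {q : Fin 3 → k} {J : Ideal (A3 k)}
    (h : ∀ a b : Fin 3, a ≠ 2 → b ≠ 2 → (X a - C (q a)) * (X b - C (q b)) ∈ J)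
    (h2 : (X 2 - C (q 2)) * (X 2 - C (q 2)) ∈ J) : mx q ^ 3 ≤ J * mx q := by
  refine cube_le fun a b c => ?_
  have key : ∀ a b c : Fin 3, ((a ≠ 2 ∧ b ≠ 2) ∨ (a = 2 ∧ b = 2)) →
      (X a - C (q a)) * (X b - C (q b)) * (X c - C (q c)) ∈ J * mx q := by
    rintro a b c (⟨ha, hb⟩ | ⟨rfl, rfl⟩)
    · exact Ideal.mul_mem_mul (h a b ha hb) (lin_mx _ _)
    · exact Ideal.mul_mem_mul h2 (lin_mx _ _)
  by_cases hab : (a ≠ 2 ∧ b ≠ 2) ∨ (a = 2 ∧ b = 2)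
  · exact key a b c hab
  by_cases hac : (a ≠ 2 ∧ c ≠ 2) ∨ (a = 2 ∧ c = 2)
  · have := key a c b hac
    rwa [mul_right_comm]
  · have := key b c a (by tauto)
    rwa [mul_assoc, mul_comm (X a - C (q a))]

lemma pt6_x (s : Fin 6) (z : ℕ) : (X 0 - C (pt6 k s z 0) : A3 k) = X 0 - (ptx s : A3 k) := by simp [pt6]
lemma pt6_y (s : Fin 6) (z : ℕ) : (X 1 - C (pt6 k s z 1) : A3 k) = X 1 - (pty s : A3 k) := by simp [pt6]

lemma two_local [CharZero k] (s : Fin 6) (z : ℕ) {J : Ideal (A3 k)} (hJ : mx (pt6 k s z) ^ 3 ≤ J)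
    (hE : ∀ i j, i ≠ j → Con k i * Con k j * Lin k i j ∈ J)
    (hz : (X 2 - C (z : k)) * (X 2 - C (z : k)) ∈ J) : mx (pt6 k s z) ^ 3 ≤ J * mx (pt6 k s z) := by
  have hx := lin_mx (pt6 k s z) 0
  have hy := lin_mx (pt6 k s z) 1
  rw [pt6_x] at hx
  rw [pt6_y] at hy
  have c3 : ∀ a b c : A3 k, a ∈ mx (pt6 k s z) → b ∈ mx (pt6 k s z) → c ∈ mx (pt6 k s z) → a * b * c ∈ J := by
    intro a b c ha hb hc
    apply hJ
    rw [pow_succ, pow_two]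
    exact Ideal.mul_mem_mul (Ideal.mul_mem_mul ha hb) hc
  have hG : ∀ a, a ≠ s → Con k a * Lin k s a ∈ J := by
    intro a ha
    refine cof (q := pt6 k s z) (a := 2) (f := Con k s) ?_ ?_ hJ ?_
    · rw [eval_Con]; exact_mod_cast conZ_ne s
    · rw [pow_two]; exact Ideal.mul_mem_mul (Con_mx z ha) (Lin_mx_left _ _ _)
    · rw [← mul_assoc]; exact hE s a ha.symm
  have hCC : ∀ a b, a ≠ s → b ≠ s → a ≠ b → Con k a * Con k b ∈ J := by
    intro a b ha hb hab
    refine cof (q := pt6 k s z) (a := 2) (f := Lin k a b) ?_ ?_ hJ ?_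
    · rw [eval_Lin]; exact_mod_cast linZ_ne a b s hab ha.symm hb.symm
    · rw [pow_two]; exact Ideal.mul_mem_mul (Con_mx z ha) (Con_mx z hb)
    · rw [mul_comm]; exact hE a b hab
  obtain ⟨h1, h2, h3⟩ := quadmem s J _ _ rfl rfl hG hCC
    (by have := c3 _ _ _ hx hx hx; convert this using 1; ring)
    (by have := c3 _ _ _ hx hx hy; convert this using 1; ring)
    (by have := c3 _ _ _ hx hy hy; convert this using 1; ring)
    (by have := c3 _ _ _ hy hy hy; convert this using 1; ring)
  · refine cube_le_two (fun a b ha hb => ?_) (by simpa [pt6] using hz)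
    have : ∀ a : Fin 3, a ≠ 2 → a = 0 ∨ a = 1 := by decide
    rcases this a ha with rfl | rfl <;> rcases this b hb with rfl | rfl <;> simp only [pt6_x, pt6_y]
    · rwa [← pow_two]
    · exact h2
    · rwa [mul_comm]
    · rwa [← pow_two]

lemma lin_det : ∀ s : Fin 6, ∃ a b : Fin 6,
    (pty a - pty s) * (ptx b - ptx s) - (ptx a - ptx s) * (pty b - pty s) ≠ 0 := by decide

lemma lin_solve [CharZero k] (s : Fin 6) {J : Ideal (A3 k)} (h : ∀ a, Lin k s a ∈ J) :
    (X 0 - (ptx s : A3 k)) ∈ J ∧ (X 1 - (pty s : A3 k)) ∈ J := by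
  obtain ⟨a, b, hab⟩ := lin_det s
  constructor
  · refine unit_mem hab ?_
    have := J.sub_mem (J.mul_mem_left (ptx b - ptx s : ℤ) (h a)) (J.mul_mem_left (ptx a - ptx s : ℤ) (h b))
    convert this using 1
    unfold Lin
    push_cast
    ring
  · refine unit_mem hab ?_
    have := J.sub_mem (J.mul_mem_left (pty b - pty s : ℤ) (h a)) (J.mul_mem_left (pty a - pty s : ℤ) (h b))
    convert this using 1
    unfold Lin
    push_cast
    ring

lemma vol15 [CharZero k] : GenA k 15 (Vol 6) := by
  refine vol_generic (q := q15 k) (e := 5) (w := w15) (D := 3) q15_inj (by norm_num) (by norm_num)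
    (fun j => by rcases w15_cases j with h | h | h <;> omega) (fun j => ?_) (by decide)
  have hZ := Z_sec (k := k)
  have two : w15 j = 2 → ((X 2 - C (((j : ℕ) / 6 : ℕ) : k)) * (X 2 - C (((j : ℕ) / 6 : ℕ) : k)) : A3 k) ∈
      Ideal.span (Sec (q15 k) 5 w15) ⊔ mx (q15 k j) ^ 3 → mx (q15 k j) ^ 3 ≤
      Ideal.span (Sec (q15 k) 5 w15) * mx (q15 k j) ^ (3 - w15 j) ⊔ mx (q15 k j) ^ (3 + 1) := by
    intro hw hz
    have := two_local (sidx j) (j / 6) (J := Ideal.span (Sec (q15 k) 5 w15) ⊔ mx (q15 k j) ^ 3)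
      le_sup_right (fun a b hab => Ideal.mem_sup_left (Ideal.subset_span (E_sec a b hab))) hz
    rw [hw]
    rw [Ideal.sup_mul] at this
    change mx (q15 k j) ^ 3 ≤ _ * mx (q15 k j) ⊔ mx (q15 k j) ^ 3 * mx (q15 k j) at this
    rwa [← pow_succ, ← pow_one (mx (q15 k j)), ← pow_mul, ← pow_mul, one_mul, one_mul] at this
  rcases w15_cases j with ⟨h, h'⟩ | ⟨h, h'⟩ | ⟨h, h'⟩
  · refine two h' ?_
    have hX := X2_mx (k := k) (sidx j) (j / 6)
    refine cof (q := q15 k j) (a := 2) (f := (X 2 - C (1 : k)) ^ 2 * (X 2 - C (2 : k))) ?_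
      (by rw [pow_two]; exact Ideal.mul_mem_mul hX hX)
      le_sup_right (Ideal.mem_sup_left (Ideal.subset_span ?_))
    · simp [q15, pt6, h]
    · convert hZ using 1
      rw [h]; simp; ring
  · refine two h' ?_
    have hX := X2_mx (k := k) (sidx j) (j / 6)
    refine cof (q := q15 k j) (a := 2) (f := (X 2) ^ 2 * (X 2 - C (2 : k))) ?_
      (by rw [pow_two]; exact Ideal.mul_mem_mul hX hX)
      le_sup_right (Ideal.mem_sup_left (Ideal.subset_span ?_))
    · simp [q15, pt6, h]
      norm_num
    · convert hZ using 1
      rw [h]; simp; ring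
  · refine sec_up (D := 1) (by omega) ?_ 2
    rw [h']
    simp only [Nat.sub_self, pow_zero, pow_one, Ideal.one_eq_top, Ideal.mul_top]
    have hX := X2_mx (k := k) (sidx j) (j / 6)
    have hl := lin_solve (k := k) (sidx j) (J := Ideal.span (Sec (q15 k) 5 w15) ⊔ mx (q15 k j) ^ 2)
      (fun a => by
        refine cof (q := q15 k j) (a := 1) (f := X 2 * (X 2 - C (1 : k)) * Con k (sidx j)) ?_ 
          (by rw [pow_one]; exact Lin_mx_left _ _ _) le_sup_right
          (Ideal.mem_sup_left (Ideal.subset_span ?_))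
        · rw [map_mul, q15, eval_Con]
          refine mul_ne_zero ?_ (by exact_mod_cast conZ_ne _)
          simp [pt6, h]
          norm_num
        · rw [mul_assoc]; exact B_sec _ _)
    refine mx_le_of fun i => ?_
    fin_cases i
    · have := hl.1
      rw [← pt6_x _ (j / 6)] at this
      exact this
    · have := hl.2
      rw [← pt6_y _ (j / 6)] at this
      exact this
    · refine cof (q := q15 k j) (a := 1) (f := X 2 ^ 2 * (X 2 - C (1 : k)) ^ 2) ?_
        (by rw [pow_one]; exact lin_mx _ _) le_sup_right (Ideal.mem_sup_left (Ideal.subset_span ?_))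
      · simp [q15, pt6, h]
        norm_num
      · convert hZ using 2
        simp [q15, pt6, h]

end FP

namespace FP
variable {k : Type*} [Field k]

/-- separators in degree `d` -/
def Sep {n : ℕ} (q : Fin n → Fin 3 → k) (d : ℕ) : Prop :=
  ∀ c : Fin n → k, ∃ g ∈ PD k d, ∀ j, eval (q j) g = c j

lemma Sep_iff {n : ℕ} {q : Fin n → Fin 3 → k} {d : ℕ} : Sep q d ↔ IndS q d (fun _ => 1) := by
  constructor
  · intro h v
    obtain ⟨g, h1, h2⟩ := h (fun j => eval (q j) (v j))
    exact ⟨g, h1, fun j => by rw [pow_one, mem_mx_one]; simp [h2]⟩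
  · intro h c
    obtain ⟨g, h1, h2⟩ := h (fun j => C (c j))
    refine ⟨g, h1, fun j => ?_⟩
    have := h2 j
    rw [pow_one, mem_mx_one] at this
    simpa [sub_eq_zero] using this

lemma Sep_of {n : ℕ} {q : Fin n → Fin 3 → k} {d : ℕ} (f : Fin n → A3 k) (h : ∀ j, f j ∈ PD k d)
    (h1 : ∀ j, eval (q j) (f j) ≠ 0) (h2 : ∀ i j, i ≠ j → eval (q i) (f j) = 0) : Sep q d := by
  intro c
  refine ⟨∑ j, C (c j / eval (q j) (f j)) * f j, Submodule.sum_mem _ fun j _ => ?_, fun i => ?_⟩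
  · rw [← smul_eq_C_mul]
    exact Submodule.smul_mem _ _ (h j)
  · rw [map_sum, Finset.sum_eq_single i]
    · simp [h1 i]
    · intro j _ hj
      simp [h2 i j hj.symm]
    · simp

lemma GenA_Sep {n : ℕ} {q0 : Fin n → Fin 3 → k} {d : ℕ} (h : Sep q0 d) :
    GenA k n (fun q => Sep q d) := by
  simp only [Sep_iff] at *
  exact GenA_IndS h

/-- falling-factorial products -/
noncomputable def Dp (k : Type*) [Field k] (α : Fin 3 →₀ ℕ) : A3 k :=
  ∏ i, ∏ c ∈ Finset.range (α i), (X i - C (c : k))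

/-- lattice points -/
def lp (k : Type*) [Field k] (α : Fin 3 →₀ ℕ) : Fin 3 → k := fun i => (α i : k)

lemma Dp_PD (α : Fin 3 →₀ ℕ) : Dp k α ∈ PD k α.degree := by
  rw [Finsupp.degree_eq_sum]
  refine PD_prod _ _ _ fun i _ => ?_
  have := PD_prod (k := k) (Finset.range (α i)) (fun c => X i - C (c : k)) (fun _ => 1)
    (fun c _ => lin_mem_PD i _)
  simpa using this

lemma Dp_eval_ne [CharZero k] {α β : Fin 3 →₀ ℕ} : eval (lp k β) (Dp k α) ≠ 0 ↔ α ≤ β := by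
  rw [Dp, eval_prod, Finset.prod_ne_zero_iff, Finsupp.le_def]
  simp only [eval_prod, Finset.prod_ne_zero_iff, Finset.mem_univ, true_imp_iff, Finset.mem_range, map_sub,
    eval_X, eval_C, lp, sub_ne_zero, ne_eq, Nat.cast_inj]
  refine forall_congr' fun i => ?_
  constructor
  · intro h
    by_contra h'
    exact h (β i) (not_le.1 h') rfl
  · intro h c hc h'
    omega

lemma eq_of_le_degree {α β : Fin 3 →₀ ℕ} (h : α ≤ β) (h' : β.degree ≤ α.degree) : α = β := by
  rw [Finsupp.le_def] at h
  rw [Finsupp.degree_eq_sum, Finsupp.degree_eq_sum, Fin.sum_univ_three, Fin.sum_univ_three] at h'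
  have h0 := h 0
  have h1 := h 1
  have h2 := h 2
  ext i
  fin_cases i <;> simp <;> omega

lemma degree_mono3 {α β : Fin 3 →₀ ℕ} (h : α ≤ β) : α.degree ≤ β.degree := by
  rw [Finsupp.le_def] at h
  rw [Finsupp.degree_eq_sum, Finsupp.degree_eq_sum]
  exact Finset.sum_le_sum fun i _ => h i

lemma Sep_lattice [CharZero k] {n d : ℕ} (a : Fin n → Fin 3 →₀ ℕ) (ha : Function.Injective a)
    (had : ∀ j, (a j).degree ≤ d) : Sep (fun j => lp k (a j)) d := by
  have key : ∀ i j, eval (lp k (a i)) (Dp k (a j) * ∏ c ∈ Finset.Ioc (a j).degree d,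
      (X 0 + X 1 + X 2 - C (c : k))) ≠ 0 ↔ i = j := by
    intro i j
    have hs : eval (lp k (a i)) (X 0 + X 1 + X 2) = (((a i).degree : ℕ) : k) := by
      rw [Finsupp.degree_eq_sum, Fin.sum_univ_three]
      simp [lp]
    rw [map_mul, mul_ne_zero_iff, Dp_eval_ne, eval_prod, Finset.prod_ne_zero_iff]
    simp only [map_sub, hs, eval_C, sub_ne_zero, ne_eq, Nat.cast_inj, Finset.mem_Ioc]
    constructor
    · rintro ⟨h1, h2⟩
      refine (ha (eq_of_le_degree h1 ?_)).symm
      by_contra h3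
      exact h2 _ ⟨not_le.1 h3, had i⟩ rfl
    · rintro rfl
      exact ⟨le_rfl, fun c hc h => by omega⟩
  refine Sep_of _ (fun j => ?_) (fun j => (key j j).2 rfl) (fun i j hij => ?_)
  · have h1 := PD_prod (k := k) (Finset.Ioc (a j).degree d) (fun c => X 0 + X 1 + X 2 - C (c : k)) (fun _ => 1)
      (fun c _ => sub_mem (add_mem (add_mem (X_mem_PD 0) (X_mem_PD 1)) (X_mem_PD 2)) (C_mem_PD _ _))
    refine PD_mono ?_ (PD_mul (Dp_PD (a j)) h1)
    have := had j
    simp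
    omega
  · by_contra h
    exact hij ((key i j).1 h)

lemma Sep_gen [CharZero k] {n d : ℕ} (h : 6 * n ≤ (d + 1) * (d + 2) * (d + 3)) :
    GenA k n (fun q => Sep q d) := by
  have hc : Fintype.card (Fin n) ≤ Fintype.card (lowf (d + 1)) := by
    have := card_lowf (d + 1)
    rw [Fintype.card_fin, Fintype.card_coe]
    nlinarith
  obtain ⟨e⟩ := Function.Embedding.nonempty_of_card_le hc
  refine GenA_Sep (Sep_lattice (k := k) (fun j => (e j).1) (fun i j hij => e.injective (Subtype.ext hij))
    (fun j => ?_))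
  have := mem_lowf.1 (e j).2
  omega

lemma GenA_forall {n m : ℕ} {P : Fin m → (Fin n → Fin 3 → k) → Prop} (h : ∀ i, GenA k n (P i)) :
    GenA k n (fun q => ∀ i, P i q) := by
  choose Φ h1 h2 using h
  refine ⟨∏ i, Φ i, Finset.prod_ne_zero_iff.2 fun i _ => h1 i, fun q hq i => h2 i q ?_⟩
  rw [evc, eval_prod, Finset.prod_ne_zero_iff] at hq
  exact hq i (Finset.mem_univ _)

lemma Sep_unisolvent {q : Fin 4 → Fin 3 → k} (h : Sep q 1) {f : A3 k} (hf : f ∈ PD k 1)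
    (h0 : ∀ j, eval (q j) f = 0) : f = 0 := by
  let L : PD k 1 →ₗ[k] (Fin 4 → k) :=
    { toFun := fun f j => eval (q j) f.1
      map_add' := by intros; funext j; simp
      map_smul' := by intros; funext j; simp }
  have hL : Function.Surjective L := by
    intro c
    obtain ⟨g, g1, g2⟩ := h c
    exact ⟨⟨g, g1⟩, funext g2⟩
  have hfr : Module.finrank k (PD k 1) = Module.finrank k (Fin 4 → k) := by
    rw [finrank_PD, Module.finrank_fin_fun]
    have := card_lowf 2
    norm_num at *
    omega
  have hi := (LinearMap.injective_iff_surjective_of_finrank_eq_finrank hfr).2 hL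
  have : (⟨f, hf⟩ : PD k 1) = 0 := hi (by rw [map_zero]; exact funext h0)
  simpa using this

end FP

namespace FP
variable {k : Type*} [Field k]

/-- restriction of (the homogenization of) a polynomial to a parametrized curve -/
noncomputable def Hc (t : ℕ) (ψ0 : Polynomial k) (ψ : Fin 3 → Polynomial k) (F : A3 k) : Polynomial k :=
  ∑ α ∈ F.support, Polynomial.C (coeff α F) * (ψ0 ^ (t - α.degree) * ∏ i, ψ i ^ α i)

lemma PD_supp {t : ℕ} {F : A3 k} (hF : F ∈ PD k t) {α : Fin 3 →₀ ℕ} (h : α ∈ F.support) : α.degree ≤ t := by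
  refine le_trans ?_ (mem_PD.1 hF)
  have := le_totalDegree h
  rwa [Finsupp.degree_eq_sum, ← Finsupp.sum_fintype α (fun _ e => e) (fun _ => rfl)]

lemma Hc_eq {t : ℕ} {ψ0 : Polynomial k} {ψ : Fin 3 → Polynomial k} {F : A3 k} (h0 : ψ0 ≠ 0) (hF : F ∈ PD k t) :
    algebraMap (Polynomial k) (RatFunc k) (Hc t ψ0 ψ F) = (algebraMap _ (RatFunc k) ψ0) ^ t *
      aeval (fun i => algebraMap _ (RatFunc k) (ψ i) / algebraMap _ (RatFunc k) ψ0) F := by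
  have h0' : algebraMap _ (RatFunc k) ψ0 ≠ 0 := by simpa using h0
  rw [Hc, aeval_def, eval₂_eq', map_sum, Finset.mul_sum]
  refine Finset.sum_congr rfl fun α hα => ?_
  have hd := PD_supp hF hα
  simp only [map_mul, map_pow, map_prod, div_pow, Finset.prod_div_distrib]
  rw [Finset.prod_pow_eq_pow_sum, ← Finsupp.degree_eq_sum]
  have : algebraMap (Polynomial k) (RatFunc k) (Polynomial.C (coeff α F)) = algebraMap k (RatFunc k) (coeff α F) := by
    rw [IsScalarTower.algebraMap_apply k (Polynomial k) (RatFunc k)]; rfl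
  rw [this]
  obtain ⟨e, rfl⟩ := Nat.exists_eq_add_of_le hd
  rw [Nat.add_sub_cancel_left, pow_add]
  field_simp

lemma Hc_tr {t : ℕ} {ψ0 : Polynomial k} {ψ : Fin 3 → Polynomial k} {F : A3 k} (h0 : ψ0 ≠ 0) (hF : F ∈ PD k t)
    (q : Fin 3 → k) : Hc t ψ0 ψ F = Hc t ψ0 (fun a => ψ a - Polynomial.C (q a) * ψ0) (tr q F) := by
  apply RatFunc.algebraMap_injective k
  rw [Hc_eq h0 hF, Hc_eq h0 (tr_PD hF)]
  have h0' : algebraMap _ (RatFunc k) ψ0 ≠ 0 := by simpa using h0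
  congr 1
  rw [tr, ← AlgHom.comp_apply, comp_aeval]
  congr 2
  funext i
  simp only [map_add, aeval_X, aeval_C, map_sub, map_mul]
  have : algebraMap (Polynomial k) (RatFunc k) (Polynomial.C (q i)) = algebraMap k (RatFunc k) (q i) := by
    rw [IsScalarTower.algebraMap_apply k (Polynomial k) (RatFunc k)]; rfl
  rw [this]
  field_simp
  ring

lemma Hc_dvd {t M : ℕ} {ψ0 p : Polynomial k} {ψ : Fin 3 → Polynomial k} {F : A3 k} (h0 : ψ0 ≠ 0) (hF : F ∈ PD k t)
    {q : Fin 3 → k} (hM : F ∈ mx q ^ M) (hp : ∀ a, p ∣ ψ a - Polynomial.C (q a) * ψ0) : p ^ M ∣ Hc t ψ0 ψ F := by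
  rw [Hc_tr h0 hF q]
  refine Finset.dvd_sum fun α hα => Dvd.dvd.mul_left (Dvd.dvd.mul_left ?_ _) _
  have hα' : M ≤ α.degree := by
    by_contra h
    exact (mem_support_iff.1 hα) (mem_mx_iff.1 hM α (not_le.1 h))
  refine (pow_dvd_pow p hα').trans ?_
  rw [Finsupp.degree_eq_sum, ← Finset.prod_pow_eq_pow_sum]
  exact Finset.prod_dvd_prod_of_dvd _ _ fun i _ => pow_dvd_pow_of_dvd (hp i) _

lemma Hc_deg {t e : ℕ} {ψ0 : Polynomial k} {ψ : Fin 3 → Polynomial k} {F : A3 k} (hF : F ∈ PD k t)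
    (h0 : ψ0.natDegree ≤ e) (h : ∀ a, (ψ a).natDegree ≤ e) : (Hc t ψ0 ψ F).natDegree ≤ e * t := by
  refine Polynomial.natDegree_sum_le_of_forall_le _ _ fun α hα => ?_
  refine (Polynomial.natDegree_C_mul_le _ _).trans ?_
  refine (Polynomial.natDegree_mul_le).trans ?_
  have h1 := Polynomial.natDegree_pow_le_of_le (t - α.degree) h0
  have h2 : (∏ i, ψ i ^ α i).natDegree ≤ ∑ i, α i * e :=
    (Polynomial.natDegree_prod_le _ _).trans
      (Finset.sum_le_sum fun i _ => Polynomial.natDegree_pow_le_of_le (α i) (h i))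
  rw [← Finset.sum_mul, ← Finsupp.degree_eq_sum] at h2
  have hd := PD_supp hF hα
  have : e * t = (t - α.degree) * e + α.degree * e := by
    rw [← add_mul, Nat.sub_add_cancel hd, mul_comm]
  omega

lemma Hc_eval {t : ℕ} {ψ0 : Polynomial k} {ψ : Fin 3 → Polynomial k} {F : A3 k} {y : Fin 3 → k}
    (h0 : ψ0.eval 0 = 1) (h : ∀ a, (ψ a).eval 0 = y a) : (Hc t ψ0 ψ F).eval 0 = eval y F := by
  rw [Hc, Polynomial.eval_finsetSum, eval_eq']
  refine Finset.sum_congr rfl fun α _ => ?_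
  simp [Polynomial.eval_prod, h0, h]

/-- the linear factor -/
noncomputable def lf (b : k) : Polynomial k := 1 - Polynomial.C b * Polynomial.X

lemma lf_natDegree_le (b : k) : (lf b).natDegree ≤ 1 := by
  unfold lf
  compute_degree

lemma lf_natDegree {b : k} (hb : b ≠ 0) : (lf b).natDegree = 1 := by
  unfold lf
  compute_degree!

lemma lf_coprime {b c : k} (h : b ≠ c) : IsCoprime (lf b) (lf c) := by
  refine ⟨Polynomial.C (c * (c - b)⁻¹), - Polynomial.C (b * (c - b)⁻¹), ?_⟩
  have h' : c - b ≠ 0 := sub_ne_zero.2 h.symm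
  have : Polynomial.C (c * (c - b)⁻¹) - Polynomial.C (b * (c - b)⁻¹) = 1 := by
    rw [← Polynomial.C_sub, ← sub_mul, mul_inv_cancel₀ h', Polynomial.C_1]
  unfold lf
  simp only [Polynomial.C_mul] at this ⊢
  linear_combination this

lemma lf_dvd_one {p : Polynomial k} (h : p.eval 1 = 0) : lf (1 : k) ∣ p := by
  have h1 : (Polynomial.X - Polynomial.C (1 : k)) ∣ p := Polynomial.dvd_iff_isRoot.2 h
  have h2 : lf (1 : k) = -(Polynomial.X - Polynomial.C (1 : k)) := by unfold lf; simp
  rw [h2]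
  exact (neg_dvd).2 h1

lemma curve_bound {t M e : ℕ} {ψ0 : Polynomial k} {ψ : Fin 3 → Polynomial k} {F : A3 k} {y : Fin 3 → k}
    {m : ℕ} {q : Fin m → Fin 3 → k} {b : Fin m → k} (hF : F ∈ PD k t) (hFy : eval y F ≠ 0)
    (hM : ∀ j, F ∈ mx (q j) ^ M)
    (h0 : ψ0.eval 0 = 1) (h : ∀ a, (ψ a).eval 0 = y a) (d0 : ψ0.natDegree ≤ e) (d : ∀ a, (ψ a).natDegree ≤ e)
    (hb : ∀ j, b j ≠ 0) (hbi : Function.Injective b)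
    (hd : ∀ j a, lf (b j) ∣ ψ a - Polynomial.C (q j a) * ψ0) : m * M ≤ e * t := by
  have hψ : ψ0 ≠ 0 := by rintro rfl; simp at h0
  have h1 : ∏ j, lf (b j) ^ M ∣ Hc t ψ0 ψ F := by
    refine Finset.prod_dvd_of_coprime ?_ fun j _ => Hc_dvd hψ hF (hM j) (hd j)
    intro i _ j _ hij
    exact (lf_coprime (hbi.ne hij)).pow
  have h2 : Hc t ψ0 ψ F ≠ 0 := by
    intro h3
    have := Hc_eval (t := t) (F := F) h0 h
    rw [h3] at this
    exact hFy (by simpa using this.symm)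
  have h3 := Polynomial.natDegree_le_of_dvd h1 h2
  have hlf : ∀ j, lf (b j) ≠ 0 := fun j hj => by
    have := lf_natDegree (hb j)
    rw [hj] at this; simp at this
  rw [Polynomial.natDegree_prod _ _ fun j _ => pow_ne_zero _ (hlf j)] at h3
  simp only [Polynomial.natDegree_pow, lf_natDegree (hb _)] at h3
  have h4 := Hc_deg (t := t) (e := e) hF d0 d
  simp at h3
  omega

lemma exists_eval_ne [Infinite k] {F : A3 k} (h : F ≠ 0) : ∃ y, eval y F ≠ 0 := by
  by_contra! h'
  exact h (MvPolynomial.funext fun y => by simpa using h' y)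

/-- a parametrized cubic -/
noncomputable def Psi (b v x : Fin 4 → k) : Polynomial k :=
  ∑ i, Polynomial.C (v i * x i) * ∏ l ∈ Finset.univ.erase i, lf (b l)

lemma Psi_sub (b v x y : Fin 4 → k) (r : k) :
    Psi b v x - Polynomial.C r * Psi b v y = Psi b v (fun i => x i - r * y i) := by
  simp only [Psi, Finset.mul_sum, ← Finset.sum_sub_distrib]
  refine Finset.sum_congr rfl fun i _ => ?_
  simp only [Polynomial.C_mul, Polynomial.C_sub]
  ring

lemma Psi_deg (b v x : Fin 4 → k) : (Psi b v x).natDegree ≤ 3 := by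
  refine Polynomial.natDegree_sum_le_of_forall_le _ _ fun i _ => ?_
  refine (Polynomial.natDegree_C_mul_le _ _).trans ((Polynomial.natDegree_prod_le _ _).trans ?_)
  refine (Finset.sum_le_sum fun l _ => lf_natDegree_le (b l)).trans ?_
  simp

lemma Psi_zero (b v x : Fin 4 → k) : (Psi b v x).eval 0 = ∑ i, v i * x i := by
  simp [Psi, lf, Polynomial.eval_finsetSum, Polynomial.eval_prod]

lemma Psi_one (c v x : Fin 4 → k) (hc : ∀ i, c i ≠ 0) (h : ∑ i, c i * x i = 0) :
    (Psi (fun i => 1 + v i / c i) v x).eval 1 = 0 := by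
  simp only [Psi, lf, Polynomial.eval_finsetSum, Polynomial.eval_prod, Polynomial.eval_mul, Polynomial.eval_sub,
    Polynomial.eval_C, Polynomial.eval_one, Polynomial.eval_X, mul_one]
  have : ∀ i, v i * x i * ∏ l ∈ Finset.univ.erase i, (1 - (1 + v l / c l)) =
      - (∏ l, (1 - (1 + v l / c l))) * (c i * x i) := by
    intro i
    rw [← Finset.mul_prod_erase Finset.univ _ (Finset.mem_univ i)]
    have := hc i
    field_simp
    ring
  simp only [this]
  rw [← Finset.mul_sum, h, mul_zero]

lemma Psi_dvd (b v x : Fin 4 → k) (i : Fin 4) (h : x i = 0) : lf (b i) ∣ Psi b v x := by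
  refine Finset.dvd_sum fun j _ => ?_
  by_cases hj : j = i
  · subst hj; simp [h]
  · exact Dvd.dvd.mul_left (Finset.dvd_prod_of_mem _ (Finset.mem_erase.2 ⟨Ne.symm hj, Finset.mem_univ _⟩)) _

lemma cubic_vol [CharZero k] {q : Fin 5 → Fin 3 → k} (hq : ∀ i : Fin 5, Sep (fun j => q (i.succAbove j)) 1) :
    Vol 5 q := by
  intro t M F hF hFt hFM
  have h4 : Sep (fun j : Fin 4 => q j.castSucc) 1 := by
    have := hq (Fin.last 4)
    simpa only [Fin.succAbove_last] using this
  choose ℓ hℓ1 hℓ2 using fun i : Fin 4 => h4 (fun j => if i = j then 1 else 0)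
  have bary : ∀ f ∈ PD k 1, f = ∑ i, C (eval (q i.castSucc) f) * ℓ i := by
    intro f hf
    rw [← sub_eq_zero]
    refine Sep_unisolvent h4 (sub_mem hf (Submodule.sum_mem _ fun i _ => ?_)) fun j => ?_
    · rw [← smul_eq_C_mul]; exact Submodule.smul_mem _ _ (hℓ1 i)
    · simp [hℓ2]
  have hc : ∀ i, eval (q (Fin.last 4)) (ℓ i) ≠ 0 := by
    intro i h0
    have : ℓ i = 0 := by
      refine Sep_unisolvent (hq i.castSucc) (hℓ1 i) fun j => ?_
      have hne : i.castSucc.succAbove j ≠ i.castSucc := Fin.succAbove_ne _ _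
      generalize i.castSucc.succAbove j = m at hne
      induction m using Fin.lastCases with
      | last => exact h0
      | cast m =>
        rw [hℓ2, if_neg]
        rintro rfl
        exact hne rfl
    have h1 := hℓ2 i i
    rw [this] at h1
    simp at h1
  set c : Fin 4 → k := fun i => eval (q (Fin.last 4)) (ℓ i) with hcdef
  have hne : F * (∏ i, ℓ i) * (∏ i, (C (c i) + ℓ i)) *
      ∏ i, ∏ j ∈ Finset.univ.erase i, (C (c j) * ℓ i - C (c i) * ℓ j) ≠ 0 := by
    have ne : ∀ (g : A3 k) (j : Fin 4), eval (q j.castSucc) g ≠ 0 → g ≠ 0 := by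
      rintro g j h rfl; simp at h
    refine mul_ne_zero (mul_ne_zero (mul_ne_zero hF ?_) ?_) ?_
    · exact Finset.prod_ne_zero_iff.2 fun i _ => ne _ i (by simp [hℓ2])
    · refine Finset.prod_ne_zero_iff.2 fun i _ => ne _ (i + 1) ?_
      have : i ≠ i + 1 := by revert i; decide
      have h5 : c i ≠ 0 := hc i
      simpa [hℓ2, this] using h5
    · refine Finset.prod_ne_zero_iff.2 fun i _ => Finset.prod_ne_zero_iff.2 fun j hj => ne _ i ?_
      have h5 : c j ≠ 0 := hc j
      simpa [hℓ2, Finset.ne_of_mem_erase hj] using h5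
  obtain ⟨y, hy⟩ := exists_eval_ne hne
  simp only [map_mul, eval_prod, mul_ne_zero_iff, Finset.prod_ne_zero_iff, map_add, map_sub, eval_C,
    Finset.mem_univ, true_imp_iff, Finset.mem_erase, and_true] at hy
  obtain ⟨⟨⟨hFy, hv⟩, hcv⟩, hbb⟩ := hy
  set v : Fin 4 → k := fun i => eval y (ℓ i) with hvdef
  have b1 : ∀ z, ∑ i, eval z (ℓ i) = 1 := by
    intro z
    have := congrArg (eval z) (bary 1 (one_mem_PD _))
    simpa using this.symm
  have bX : ∀ z a, ∑ i, eval z (ℓ i) * q i.castSucc a = z a := by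
    intro z a
    have := congrArg (eval z) (bary (X a) (X_mem_PD _))
    simp only [eval_X, map_sum, map_mul, eval_C] at this
    rw [this]
    exact Finset.sum_congr rfl fun i _ => mul_comm _ _
  set b : Fin 4 → k := fun i => 1 + v i / c i with hb
  have hc' : ∀ i, c i ≠ 0 := hc
  have hv' : ∀ i, v i ≠ 0 := hv
  have hb0 : ∀ i, b i ≠ 0 := by
    intro i h
    have := hc' i
    apply hcv i
    simp only [hb] at h
    field_simp at h
    rw [mul_zero] at h
    exact h
  have hb1 : ∀ i, b i ≠ 1 := by
    intro i h
    simp only [hb, add_eq_left, div_eq_zero_iff] at h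
    rcases h with h | h
    · exact hv' i h
    · exact hc' i h
  have hbi : ∀ i j, b i = b j → i = j := by
    intro i j h
    by_contra hij
    apply hbb i j (Ne.symm hij)
    simp only [hb, add_right_inj] at h
    rw [div_eq_div_iff (hc' i) (hc' j)] at h
    change c j * v i - c i * v j = 0
    linear_combination h
  refine curve_bound (m := 5) (e := 3) (ψ0 := Psi b v (fun _ => 1)) (ψ := fun a => Psi b v (fun i => q i.castSucc a))
    (b := Fin.snoc (α := fun _ => k) b 1) (y := y) hFt hFy hFM ?_ ?_ (Psi_deg _ _ _) (fun a => Psi_deg _ _ _) ?_ ?_ ?_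
  · rw [Psi_zero]; simpa using b1 y
  · intro a; rw [Psi_zero]; exact bX y a
  · intro j
    induction j using Fin.lastCases with
    | last => rw [Fin.snoc_last]; exact one_ne_zero
    | cast j => simpa using hb0 j
  · intro i j
    induction i using Fin.lastCases with
    | last =>
      induction j using Fin.lastCases with
      | last => simp
      | cast j => intro h; rw [Fin.snoc_last, Fin.snoc_castSucc] at h; exact absurd h.symm (hb1 j)
    | cast i =>
      induction j using Fin.lastCases with
      | last => intro h; rw [Fin.snoc_last, Fin.snoc_castSucc] at h; exact absurd h (hb1 i)
      | cast j => intro h; rw [hbi i j (by simpa using h)]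
  · intro j a
    rw [Psi_sub]
    induction j using Fin.lastCases with
    | last =>
      rw [Fin.snoc_last]
      refine lf_dvd_one (Psi_one c v _ hc' ?_)
      simp only [mul_one, mul_sub, Finset.sum_sub_distrib, ← Finset.sum_mul]
      rw [bX (q (Fin.last 4)) a, b1]
      ring
    | cast j =>
      rw [Fin.snoc_castSucc]
      exact Psi_dvd b v _ j (by simp)

lemma vol5 [CharZero k] : GenA k 5 (Vol 5) := by
  have h : ∀ i : Fin 5, GenA k 5 (fun q => Sep (fun j => q (i.succAbove j)) 1) := fun i =>
    (Sep_gen (k := k) (n := 4) (d := 1) (by norm_num)).pull (Fin.succAboveEmb i)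
  exact (GenA_forall h).mono fun q hq => cubic_vol hq

end FP

namespace FP
variable {k : Type*} [Field k]

/-- polynomials of degree at most `s` vanishing at the points -/
def W {n : ℕ} (q : Fin n → Fin 3 → k) (s : ℕ) : Submodule k (A3 k) where
  carrier := {f | f ∈ PD k s ∧ ∀ j, eval (q j) f = 0}
  add_mem' := by
    rintro a b ⟨h1, h2⟩ ⟨h3, h4⟩
    exact ⟨add_mem h1 h3, fun j => by simp [h2, h4]⟩
  zero_mem' := ⟨zero_mem _, fun j => by simp⟩
  smul_mem' := by
    rintro c a ⟨h1, h2⟩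
    exact ⟨Submodule.smul_mem _ _ h1, fun j => by simp [h2]⟩

lemma mem_W {n : ℕ} {q : Fin n → Fin 3 → k} {s : ℕ} {f : A3 k} :
    f ∈ W q s ↔ f ∈ PD k s ∧ ∀ j, eval (q j) f = 0 := Iff.rfl

lemma C_mul_mem {S : Submodule k (A3 k)} {f : A3 k} (c : k) (h : f ∈ S) : C c * f ∈ S := by
  rw [← smul_eq_C_mul]; exact Submodule.smul_mem _ _ h

lemma PD_mul_le (a b : ℕ) : PD k a * PD k b ≤ PD k (a + b) :=
  Submodule.mul_le.2 fun _ h1 _ h2 => PD_mul h1 h2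

/-- division with remainder at the origin -/
lemma div_zero_aux {u : ℕ} {f : A3 k} (hf : f ∈ PD k (u + 1)) :
    ∃ F : Fin 3 → A3 k, (∀ a, F a ∈ PD k u) ∧ f = C (coeff 0 f) + ∑ a, X a * F a := by
  have hm : ∀ α ∈ f.support, ∃ F : Fin 3 → A3 k, (∀ a, F a ∈ PD k u) ∧
      monomial α (coeff α f) = C (if α = 0 then coeff α f else 0) + ∑ a, X a * F a := by
    intro α hα
    by_cases h0 : α = 0
    · subst h0
      exact ⟨fun _ => 0, fun _ => zero_mem _, by simp⟩
    · obtain ⟨a, ha⟩ : ∃ a, α a ≠ 0 := by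
        by_contra! h
        exact h0 (Finsupp.ext h)
      have hd := PD_supp hf hα
      have hle : Finsupp.single a 1 ≤ α := by
        rw [Finsupp.single_le_iff]; omega
      have hdd : (α - Finsupp.single a 1).degree + 1 = α.degree := by
        conv_rhs => rw [← tsub_add_cancel_of_le hle]
        simp
      refine ⟨Pi.single a (monomial (α - Finsupp.single a 1) (coeff α f)), fun b => ?_, ?_⟩
      · by_cases hb : b = a
        · subst hb
          rw [Pi.single_eq_same, mem_PD]
          refine (totalDegree_monomial_le _ _).trans ?_
          have h2 : ((α - Finsupp.single b 1).sum fun _ => id) = (α - Finsupp.single b 1).degree := by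
            rw [Finsupp.degree_eq_sum, Finsupp.sum_fintype _ _ (fun _ => rfl)]; rfl
          rw [h2]; omega
        · rw [Pi.single_eq_of_ne hb]; exact zero_mem _
      · rw [if_neg h0, C_0, zero_add, Finset.sum_eq_single a]
        · rw [Pi.single_eq_same, X, monomial_mul, one_mul, add_tsub_cancel_of_le hle]
        · intro b _ hb; rw [Pi.single_eq_of_ne hb, mul_zero]
        · simp
  choose! F h1 h2 using hm
  refine ⟨fun a => ∑ α ∈ f.support, F α a, fun a => Submodule.sum_mem _ fun α hα => h1 α hα a, ?_⟩
  conv_lhs => rw [f.as_sum]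
  rw [Finset.sum_congr rfl h2, Finset.sum_add_distrib]
  congr 1
  · rw [← map_sum]
    congr 1
    rw [Finset.sum_ite_eq']
    by_cases h : (0 : Fin 3 →₀ ℕ) ∈ f.support
    · rw [if_pos h]
    · rw [if_neg h]
      exact (notMem_support_iff.1 h).symm
  · rw [Finset.sum_comm]
    simp only [Finset.mul_sum]

lemma div_at {u : ℕ} {f : A3 k} (hf : f ∈ PD k (u + 1)) (q : Fin 3 → k) :
    ∃ F : Fin 3 → A3 k, (∀ a, F a ∈ PD k u) ∧ f = C (eval q f) + ∑ a, (X a - C (q a)) * F a := by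
  obtain ⟨F, h1, h2⟩ := div_zero_aux (tr_PD (q := q) hf)
  refine ⟨fun a => tr (-q) (F a), fun a => tr_PD (h1 a), ?_⟩
  have := congrArg (tr (-q)) h2
  rw [tr_neg_tr, eval_tr] at this
  rw [this]
  simp only [map_add, map_sum, map_mul]
  congr 1
  · simp [tr]
  · refine Finset.sum_congr rfl fun a _ => ?_
    simp [tr, sub_eq_add_neg]

lemma W_succ {n : ℕ} {q : Fin n → Fin 3 → k} {d u : ℕ} (hS : Sep q d) (hu : d + 1 ≤ u) :
    W q (u + 1) ≤ W q u * PD k 1 := by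
  intro f hf
  obtain ⟨F, h1, h2⟩ := div_zero_aux hf.1
  choose g g1 g2 using fun a => hS (fun j => eval (q j) (F a))
  have hW : ∀ a, F a - g a ∈ W q u := fun a =>
    ⟨sub_mem (h1 a) (PD_mono (by omega) (g1 a)), fun j => by simp [g2]⟩
  have hR : C (coeff 0 f) + ∑ a, X a * g a ∈ W q u := by
    refine ⟨add_mem (C_mem_PD _ _) (Submodule.sum_mem _ fun a _ => PD_mono ?_ (PD_mul (X_mem_PD a) (g1 a))),
      fun j => ?_⟩
    · omega
    · have := hf.2 j
      rw [h2] at this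
      simpa [g2] using this
  have : f = (C (coeff 0 f) + ∑ a, X a * g a) * 1 + ∑ a, (F a - g a) * X a := by
    conv_lhs => rw [h2]
    rw [mul_one, add_assoc, ← Finset.sum_add_distrib]
    congr 1
    refine Finset.sum_congr rfl fun a _ => ?_
    ring
  rw [this]
  exact add_mem (Submodule.mul_mem_mul hR (one_mem_PD _))
    (Submodule.sum_mem _ fun a _ => Submodule.mul_mem_mul (hW a) (X_mem_PD a))

lemma W_add {n : ℕ} {q : Fin n → Fin 3 → k} {d : ℕ} (hS : Sep q d) (e : ℕ) :
    W q (d + 1 + e) ≤ W q (d + 1) * PD k e := by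
  induction e with
  | zero =>
    intro f hf
    rw [← mul_one f]
    exact Submodule.mul_mem_mul hf (one_mem_PD _)
  | succ e ih =>
    refine (W_succ (u := d + 1 + e) hS (by omega)).trans ((mul_le_mul_left ih _).trans ?_)
    rw [mul_assoc]
    exact mul_le_mul_right (PD_mul_le e 1) _

lemma W_pow_mx {n : ℕ} {q : Fin n → Fin 3 → k} {s : ℕ} (j : Fin n) (i : ℕ) {f : A3 k} (h : f ∈ W q s ^ i) :
    f ∈ mx (q j) ^ i := by
  induction i generalizing f with
  | zero => simp
  | succ i ih =>
    rw [pow_succ] at h ⊢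
    induction h using Submodule.mul_induction_on' with
    | mem_mul_mem a ha b hb => exact Ideal.mul_mem_mul (ih ha) (mem_mx_one.2 (hb.2 j))
    | add a _ b _ ha hb => exact add_mem ha hb

/-- second-order part -/
noncomputable def H2 {n : ℕ} (q : Fin n → Fin 3 → k) (s : ℕ) (j : Fin n) : Submodule k (A3 k) :=
  W q s ⊓ (mx (q j) ^ 2).restrictScalars k

/-- auxiliary filtration -/
noncomputable def Nn {n : ℕ} (q : Fin n → Fin 3 → k) (s : ℕ) (j : Fin n) : ℕ → Submodule k (A3 k)
  | 0 => ⊥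
  | i + 1 => H2 q s j * W q s ^ i

end FP

namespace FP
variable {k : Type*} [Field k]

/-- separators -/
structure SepF {n : ℕ} (q : Fin n → Fin 3 → k) (d : ℕ) (f : Fin n → A3 k) : Prop where
  deg : ∀ j, f j ∈ PD k d
  one : ∀ j, eval (q j) (f j) = 1
  zero : ∀ i j, i ≠ j → eval (q i) (f j) = 0

lemma Sep.sepF {n : ℕ} {q : Fin n → Fin 3 → k} {d : ℕ} (h : Sep q d) : ∃ f, SepF q d f := by
  choose f h1 h2 using fun j : Fin n => h (fun i => if i = j then 1 else 0)
  exact ⟨f, h1, fun j => by simp [h2], fun i j hij => by simp [h2, hij]⟩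

variable {n : ℕ} {q : Fin n → Fin 3 → k} {d : ℕ} {f : Fin n → A3 k}

lemma SepF.mul_mem (hf : SepF q d f) {j : Fin n} {g : A3 k} (hg : g ∈ PD k 1) (h0 : eval (q j) g = 0) :
    f j * g ∈ W q (d + 1) := by
  refine ⟨PD_mul (hf.deg j) hg, fun i => ?_⟩
  by_cases h : i = j
  · subst h; simp [h0]
  · simp [hf.zero i j h]

lemma SepF.pair (hf : SepF q d f) {i j : Fin n} (hij : i ≠ j) {g : A3 k} (hg : g ∈ PD k 1)
    (hi : eval (q i) g = 0) (hj : eval (q j) g = 0) : f i * f j * g ∈ W q (d + 1) * W q (d + 1) := by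
  have hq : q i ≠ q j := by
    intro h
    have h1 := hf.zero i j hij
    rw [h, hf.one] at h1
    exact one_ne_zero h1
  obtain ⟨a, ha⟩ := Function.ne_iff.1 hq
  have ha' : q i a - q j a ≠ 0 := sub_ne_zero.2 ha
  have hx : C ((q i a - q j a)⁻¹) * (X a - C (q j a)) ∈ PD k 1 := C_mul_mem _ (lin_mem_PD a _)
  have h1 : f j * (C ((q i a - q j a)⁻¹) * (X a - C (q j a))) ∈ W q (d + 1) := hf.mul_mem hx (by simp)
  have h2 : f i * (1 - C ((q i a - q j a)⁻¹) * (X a - C (q j a))) ∈ W q (d + 1) :=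
    hf.mul_mem (sub_mem (one_mem_PD _) hx) (by simp [inv_mul_cancel₀ ha'])
  have := add_mem (Submodule.mul_mem_mul h1 (hf.mul_mem hg hi)) (Submodule.mul_mem_mul h2 (hf.mul_mem hg hj))
  convert this using 1
  ring

lemma H2_lin {j : Fin n} {s : ℕ} {h : A3 k} (hh : h ∈ H2 q (s + 1) j) :
    ∃ F : Fin 3 → A3 k, (∀ a, F a ∈ PD k s) ∧ (∀ a, eval (q j) (F a) = 0) ∧
      h = ∑ a, (X a - C (q j a)) * F a := by
  obtain ⟨F, h1, h2⟩ := div_at hh.1.1 (q j)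
  rw [hh.1.2 j, C_0, zero_add] at h2
  refine ⟨F, h1, fun a => ?_, h2⟩
  have h3 : coeff (Finsupp.single a 1) (tr (q j) h) = 0 :=
    mem_mx_iff.1 hh.2 _ (by simp)
  rw [h2, map_sum, coeff_sum, Finset.sum_eq_single a] at h3
  · rw [map_mul, show tr (q j) (X a - C (q j a)) = X a by simp [tr], coeff_X_mul'] at h3
    simpa [eval_tr] using h3
  · intro b _ hb
    rw [map_mul, show tr (q j) (X b - C (q j b)) = X b by simp [tr], coeff_X_mul', if_neg]
    simpa using hb
  · simp

lemma SepF.mul_H2 (hf : SepF q d f) {j : Fin n} {h : A3 k} (hh : h ∈ H2 q (d + 1) j) :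
    f j * h ∈ W q (d + 1) * W q (d + 1) := by
  obtain ⟨F, h1, h2, h3⟩ := H2_lin hh
  have key : f j * h = ∑ a, f j * (X a - C (q j a)) * (F a - ∑ i, C (eval (q i) (F a)) * f i) +
      ∑ i, f i * f j * ∑ a, C (eval (q i) (F a)) * (X a - C (q j a)) := by
    have e : ∑ i, f i * f j * ∑ a, C (eval (q i) (F a)) * (X a - C (q j a)) =
        ∑ a, f j * (X a - C (q j a)) * ∑ i, C (eval (q i) (F a)) * f i := by
      simp only [Finset.mul_sum]
      rw [Finset.sum_comm]
      refine Finset.sum_congr rfl fun a _ => Finset.sum_congr rfl fun i _ => ?_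
      ring
    rw [e, h3, ← Finset.sum_add_distrib, Finset.mul_sum]
    refine Finset.sum_congr rfl fun a _ => ?_
    ring
  rw [key]
  refine add_mem (Submodule.sum_mem _ fun a _ => Submodule.mul_mem_mul (hf.mul_mem (lin_mem_PD a _) (by simp)) ?_)
    (Submodule.sum_mem _ fun i _ => ?_)
  · refine ⟨PD_mono (Nat.le_succ d) (sub_mem (h1 a) (Submodule.sum_mem _ fun i _ => C_mul_mem _ (hf.deg i))), fun l => ?_⟩
    rw [map_sub, map_sum, Finset.sum_eq_single l]
    · simp [hf.one]
    · intro i _ hi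
      simp [hf.zero l i hi.symm]
    · simp
  · by_cases hij : i = j
    · subst hij
      simp only [h2, C_0, zero_mul, Finset.sum_const_zero, mul_zero]
      exact zero_mem _
    · refine hf.pair hij (Submodule.sum_mem _ fun a _ => C_mul_mem _ (lin_mem_PD a _)) ?_ (by simp)
      have := hh.1.2 i
      rw [h3] at this
      rw [← this]
      simp [mul_comm]

lemma Nn_mul_W (s : ℕ) (j : Fin n) (i : ℕ) : Nn q s j i * W q s ≤ Nn q s j (i + 1) := by
  cases i with
  | zero => simp [Nn]
  | succ i => rw [Nn, Nn, mul_assoc, ← pow_succ]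

lemma Nn_mx {s : ℕ} {j : Fin n} {i : ℕ} {g : A3 k} (h : g ∈ Nn q s j i) : g ∈ mx (q j) ^ (i + 1) := by
  cases i with
  | zero => simp only [Nn, Submodule.mem_bot] at h; simp [h]
  | succ i =>
    rw [Nn] at h
    induction h using Submodule.mul_induction_on' with
    | mem_mul_mem a ha b hb => exact mul_mem_mx ha.2 (W_pow_mx j i hb) (by omega)
    | add a _ b _ ha hb => exact add_mem ha hb

lemma SepF.decomp (hf : SepF q d f) {j : Fin n} {w : A3 k} (hw : w ∈ W q (d + 1)) :
    ∃ P : A3 k, P.IsHomogeneous 1 ∧ w - f j * tr (-(q j)) P ∈ H2 q (d + 1) j ∧ f j * tr (-(q j)) P ∈ W q (d + 1) := by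
  obtain ⟨F, h1, h2⟩ := div_at hw.1 (q j)
  rw [hw.2 j, C_0, zero_add] at h2
  have hP : tr (-(q j)) (∑ a, C (eval (q j) (F a)) * X a) = ∑ a, C (eval (q j) (F a)) * (X a - C (q j a)) := by
    rw [map_sum]
    refine Finset.sum_congr rfl fun a _ => ?_
    simp [tr, sub_eq_add_neg]
  have hW : f j * tr (-(q j)) (∑ a, C (eval (q j) (F a)) * X a) ∈ W q (d + 1) := by
    rw [hP]
    exact hf.mul_mem (Submodule.sum_mem _ fun a _ => C_mul_mem _ (lin_mem_PD a _)) (by simp)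
  refine ⟨∑ a, C (eval (q j) (F a)) * X a, ?_, ⟨sub_mem hw hW, ?_⟩, hW⟩
  · exact IsHomogeneous.sum _ _ _ fun a _ => by
      simpa using (isHomogeneous_C _ _).mul (isHomogeneous_X k a)
  · change _ ∈ mx (q j) ^ 2
    rw [hP]
    have : w - f j * ∑ a, C (eval (q j) (F a)) * (X a - C (q j a)) =
      ∑ a, (X a - C (q j a)) * (F a - C (eval (q j) (F a)) * f j) := by
      conv_lhs => rw [h2]
      rw [Finset.mul_sum, ← Finset.sum_sub_distrib]
      refine Finset.sum_congr rfl fun a _ => ?_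
      ring
    rw [this, pow_two]
    refine Ideal.sum_mem _ fun a _ => Ideal.mul_mem_mul (lin_mx _ _) ?_
    rw [mem_mx_one]
    simp [hf.one]

lemma SepF.decomp_pow (hf : SepF q d f) (j : Fin n) (i : ℕ) {g : A3 k} (hg : g ∈ W q (d + 1) ^ i) :
    ∃ P : A3 k, P.IsHomogeneous i ∧ g - f j ^ i * tr (-(q j)) P ∈ Nn q (d + 1) j i := by
  induction i generalizing g with
  | zero =>
    rw [pow_zero, Submodule.mem_one] at hg
    obtain ⟨c, rfl⟩ := hg
    refine ⟨C c, isHomogeneous_C _ _, ?_⟩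
    simp [Nn, tr, algebraMap_eq]
  | succ i ih =>
    rw [pow_succ] at hg
    induction hg using Submodule.mul_induction_on' with
    | mem_mul_mem a ha b hb =>
      obtain ⟨P, P1, P2⟩ := ih ha
      obtain ⟨Q, Q1, Q2, Q3⟩ := hf.decomp (j := j) hb
      refine ⟨P * Q, P1.mul Q1, ?_⟩
      have e1 : (b - f j * tr (-(q j)) Q) * a ∈ Nn q (d + 1) j (i + 1) := Submodule.mul_mem_mul Q2 ha
      have e2 := Nn_mul_W _ _ _ (Submodule.mul_mem_mul P2 Q3)
      convert add_mem e1 e2 using 1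
      rw [map_mul]
      ring
    | add a _ b _ ha hb =>
      obtain ⟨P, P1, P2⟩ := ha
      obtain ⟨Q, Q1, Q2⟩ := hb
      refine ⟨P + Q, P1.add Q1, ?_⟩
      convert add_mem P2 Q2 using 1
      rw [map_add]
      ring

lemma SepF.mul_of_mx (hf : SepF q d f) (j : Fin n) (i : ℕ) {g : A3 k} (hg : g ∈ W q (d + 1) ^ i)
    (h : g ∈ mx (q j) ^ (i + 1)) : f j * g ∈ W q (d + 1) ^ (i + 1) := by
  obtain ⟨P, P1, P2⟩ := hf.decomp_pow j i hg
  have h1 : f j ^ i * tr (-(q j)) P ∈ mx (q j) ^ (i + 1) := by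
    have := sub_mem h (Nn_mx P2)
    rwa [sub_sub_cancel] at this
  have h2 := mx_cancel (by simp [hf.one]) h1
  have h3 : P = 0 := by
    rw [mem_mx_iff, tr_tr_neg] at h2
    ext α
    by_cases hα : α.degree = i
    · simpa using h2 α (by omega)
    · simpa using P1.coeff_eq_zero hα
  rw [h3, map_zero, mul_zero, sub_zero] at P2
  cases i with
  | zero =>
    simp only [Nn, Submodule.mem_bot] at P2
    rw [P2, mul_zero]; exact zero_mem _
  | succ i =>
    rw [Nn] at P2
    rw [pow_succ', pow_succ', ← mul_assoc]
    clear hg h h1 h2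
    induction P2 using Submodule.mul_induction_on' with
    | mem_mul_mem a ha b hb =>
      rw [← mul_assoc]
      exact Submodule.mul_mem_mul (hf.mul_H2 ha) hb
    | add a _ b _ ha hb =>
      rw [mul_add]
      exact add_mem ha hb

lemma SepF.split (hf : SepF q d f) (hS : Sep q d) {i e : ℕ} {g : A3 k} (hg : g ∈ W q (d + 1) ^ i * PD k (d + 1 + e)) :
    ∃ G : Fin n → A3 k, (∀ j, G j ∈ W q (d + 1) ^ i) ∧
      g - ∑ j, f j * G j ∈ W q (d + 1) ^ (i + 1) * PD k e := by
  induction hg using Submodule.mul_induction_on' with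
  | mem_mul_mem a ha b hb =>
    refine ⟨fun j => C (eval (q j) b) * a, fun j => C_mul_mem _ ha, ?_⟩
    have hb' : b - ∑ j, C (eval (q j) b) * f j ∈ W q (d + 1 + e) := by
      refine ⟨sub_mem hb (Submodule.sum_mem _ fun j _ => C_mul_mem _ (PD_mono (by omega) (hf.deg j))), fun l => ?_⟩
      rw [map_sub, map_sum, Finset.sum_eq_single l]
      · simp [hf.one]
      · intro i _ hi
        simp [hf.zero l i hi.symm]
      · simp
    rw [pow_succ, mul_assoc]
    have := Submodule.mul_mem_mul ha (W_add hS e hb')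
    convert this using 1
    rw [mul_sub, Finset.mul_sum]
    congr 1
    refine Finset.sum_congr rfl fun j _ => ?_
    ring
  | add a _ b _ ha hb =>
    obtain ⟨G, G1, G2⟩ := ha
    obtain ⟨G', G3, G4⟩ := hb
    refine ⟨fun j => G j + G' j, fun j => add_mem (G1 j) (G3 j), ?_⟩
    convert add_mem G2 G4 using 1
    simp only [mul_add, Finset.sum_add_distrib]
    ring

lemma WPD_mx {s e : ℕ} (j : Fin n) {i : ℕ} {g : A3 k} (h : g ∈ W q s ^ i * PD k e) : g ∈ mx (q j) ^ i := by
  induction h using Submodule.mul_induction_on' with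
  | mem_mul_mem a ha b hb => exact Ideal.mul_mem_right _ _ (W_pow_mx j i ha)
  | add a _ b _ ha hb => exact add_mem ha hb

theorem regularity (hS : Sep q d) {r t : ℕ} (ht : r * (d + 1) ≤ t) {g : A3 k} (hg : g ∈ PD k t)
    (hm : ∀ j, g ∈ mx (q j) ^ r) : g ∈ W q (d + 1) ^ r * PD k (t - r * (d + 1)) := by
  obtain ⟨f, hf⟩ := hS.sepF
  have key : ∀ i ≤ r, g ∈ W q (d + 1) ^ i * PD k (t - i * (d + 1)) := by
    intro i
    induction i with
    | zero => intro _; simpa using hg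
    | succ i ih =>
      intro hi
      have h1 := ih (by omega)
      have h5 : (i + 1) * (d + 1) ≤ r * (d + 1) := Nat.mul_le_mul_right _ hi
      rw [show t - i * (d + 1) = d + 1 + (t - (i + 1) * (d + 1)) by
        have : (i + 1) * (d + 1) = i * (d + 1) + (d + 1) := by ring
        omega] at h1
      obtain ⟨G, G1, G2⟩ := hf.split hS h1
      have h3 : ∀ j, f j * G j ∈ W q (d + 1) ^ (i + 1) := by
        intro j
        refine hf.mul_of_mx j i (G1 j) ?_
        refine mx_cancel (f := f j) (by simp [hf.one]) ?_
        have h4 : f j * G j = g - (g - ∑ l, f l * G l) - ∑ l ∈ Finset.univ.erase j, f l * G l := by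
          rw [← Finset.add_sum_erase _ _ (Finset.mem_univ j)]
          ring
        rw [h4]
        refine sub_mem (sub_mem (mx_pow_anti _ hi (hm j)) (WPD_mx j G2)) (Ideal.sum_mem _ fun l hl => ?_)
        rw [pow_succ']
        exact Ideal.mul_mem_mul (mem_mx_one.2 (hf.zero j l (Finset.ne_of_mem_erase hl).symm)) (W_pow_mx j i (G1 l))
      have h6 : ∑ j, f j * G j ∈ W q (d + 1) ^ (i + 1) * PD k (t - (i + 1) * (d + 1)) := by
        refine Submodule.sum_mem _ fun j _ => ?_
        rw [← mul_one (f j * G j)]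
        exact Submodule.mul_mem_mul (h3 j) (one_mem_PD _)
      have := add_mem G2 h6
      rwa [sub_add_cancel] at this
  exact key r le_rfl

end FP

namespace FP
variable {k : Type*} [Field k]

/-- dehomogenization -/
noncomputable def dh (k : Type*) [Field k] : MvPolynomial (Fin 4) k →ₐ[k] A3 k :=
  aeval (Fin.cons 1 X : Fin 4 → A3 k)

lemma eval_dh (q : Fin 3 → k) (F : MvPolynomial (Fin 4) k) :
    eval q (dh k F) = eval (Fin.cons 1 q : Fin 4 → k) F := by
  have : (eval q).comp (dh k : MvPolynomial (Fin 4) k →+* A3 k) = eval (Fin.cons 1 q : Fin 4 → k) := by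
    ext i
    · simp [dh]
    · refine Fin.cases ?_ (fun j => ?_) i <;> simp [dh]
  exact DFunLike.congr_fun this F

lemma eval_hsmul {F : MvPolynomial (Fin 4) k} {t : ℕ} (hF : F.IsHomogeneous t) (c : k) (x : Fin 4 → k) :
    eval (c • x) F = c ^ t * eval x F := by
  rw [eval_eq', eval_eq', Finset.mul_sum]
  refine Finset.sum_congr rfl fun d hd => ?_
  have h := hF (mem_support_iff.1 hd)
  have h2 : ∑ i, d i = t := by
    rw [← h, Finsupp.weight_apply, Finsupp.sum_fintype _ _ (fun _ => by simp)]
    simp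
  simp only [Pi.smul_apply, smul_eq_mul, mul_pow, Finset.prod_mul_distrib, Finset.prod_pow_eq_pow_sum, h2]
  ring

lemma dh_PD {F : MvPolynomial (Fin 4) k} {t : ℕ} (hF : F.IsHomogeneous t) : dh k F ∈ PD k t := by
  rw [F.as_sum, map_sum]
  refine Submodule.sum_mem _ fun d hd => ?_
  have h := hF (mem_support_iff.1 hd)
  have h2 : ∑ i, d i = t := by
    rw [← h, Finsupp.weight_apply, Finsupp.sum_fintype _ _ (fun _ => by simp)]
    simp
  rw [dh, aeval_monomial, Finsupp.prod_fintype _ _ (fun _ => by simp)]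
  rw [algebraMap_eq]
  refine C_mul_mem _ ?_
  rw [← h2]
  refine PD_prod _ _ _ fun i _ => ?_
  rw [← mul_one (d i)]
  refine PD_mono (by simp) (PD_pow (d := 1) ?_ (d i * 1))
  refine Fin.cases ?_ (fun j => ?_) i
  · exact one_mem_PD 1
  · exact X_mem_PD j

lemma dh_inj [Infinite k] {F : MvPolynomial (Fin 4) k} {t : ℕ} (hF : F.IsHomogeneous t)
    (h : dh k F = 0) : F = 0 := by
  have h1 : X 0 * F = 0 := by
    refine MvPolynomial.funext fun x => ?_
    rw [map_mul, eval_X, map_zero]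
    by_cases hx : x 0 = 0
    · simp [hx]
    · have hx2 : x = x 0 • (Fin.cons 1 (fun i => (x 0)⁻¹ * x i.succ) : Fin 4 → k) := by
        funext i
        refine Fin.cases ?_ (fun j => ?_) i
        · simp
        · simp [hx]
      conv_lhs => rw [hx2]
      rw [eval_hsmul hF, ← eval_dh, h]
      simp
  rcases mul_eq_zero.1 h1 with h2 | h2
  · exact absurd h2 (X_ne_zero 0)
  · exact h2

lemma hom_exists {g : A3 k} {t : ℕ} (hg : g ∈ PD k t) :
    ∃ G : MvPolynomial (Fin 4) k, G.IsHomogeneous t ∧ dh k G = g := by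
  refine ⟨∑ α ∈ g.support, monomial (Finsupp.cons (t - α.degree) α) (coeff α g),
    IsHomogeneous.sum _ _ _ fun α hα => ?_, ?_⟩
  · refine isHomogeneous_monomial _ ?_
    have := PD_supp hg hα
    rw [Finsupp.degree_eq_sum, Fin.sum_univ_succ]
    simp only [Finsupp.cons_zero, Finsupp.cons_succ]
    rw [← Finsupp.degree_eq_sum]
    omega
  · rw [map_sum]
    conv_rhs => rw [g.as_sum]
    refine Finset.sum_congr rfl fun α _ => ?_
    rw [dh, aeval_monomial, Finsupp.prod_fintype _ _ (fun _ => by simp), Fin.prod_univ_succ, monomial_eq,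
      Finsupp.prod_fintype _ _ (fun _ => by simp)]
    simp

/-- Lifting a subspace to forms in an ideal. -/
def Lift (V : Submodule k (A3 k)) (d : ℕ) (J : Ideal (MvPolynomial (Fin 4) k)) : Prop :=
  ∀ g ∈ V, ∃ G : MvPolynomial (Fin 4) k, G.IsHomogeneous d ∧ G ∈ J ∧ dh k G = g

lemma Lift.mul {V V' : Submodule k (A3 k)} {d d' : ℕ} {J J' : Ideal (MvPolynomial (Fin 4) k)}
    (h : Lift V d J) (h' : Lift V' d' J') : Lift (V * V') (d + d') (J * J') := by
  intro g hg
  refine Submodule.mul_induction_on hg ?_ ?_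
  · intro a ha b hb
    obtain ⟨A, A1, A2, rfl⟩ := h a ha
    obtain ⟨B, B1, B2, rfl⟩ := h' b hb
    exact ⟨A * B, A1.mul B1, Ideal.mul_mem_mul A2 B2, map_mul _ _ _⟩
  · rintro a b ⟨A, A1, A2, rfl⟩ ⟨B, B1, B2, rfl⟩
    exact ⟨A + B, A1.add B1, add_mem A2 B2, map_add _ _ _⟩

lemma Lift.pow {V : Submodule k (A3 k)} {d : ℕ} {J : Ideal (MvPolynomial (Fin 4) k)}
    (h : Lift V d J) (r : ℕ) : Lift (V ^ r) (r * d) (J ^ r) := by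
  induction r with
  | zero =>
    intro g hg
    rw [pow_zero, Submodule.one_eq_range] at hg
    obtain ⟨c, rfl⟩ := hg
    refine ⟨C c, by simpa using isHomogeneous_C _ c, by simp, ?_⟩
    rw [dh, aeval_C]; rfl
  | succ r ih =>
    have := Lift.mul ih h
    rw [pow_succ, pow_succ, Nat.succ_mul]
    exact this

lemma Lift_PD (u : ℕ) : Lift (PD k u) u (maxIdeal k 3 ^ u) := by
  intro g hg
  obtain ⟨G, h1, h2⟩ := hom_exists hg
  refine ⟨G, h1, ?_, h2⟩
  have : maxIdeal k 3 = idealOfVars (Fin 4) k := rfl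
  rw [this, mem_pow_idealOfVars_iff]
  intro d hd
  have h := h1 (mem_support_iff.1 hd)
  rw [Finsupp.degree_eq_weight_one]
  exact h.ge

lemma Lift_W {n : ℕ} {q : Fin n → Fin 3 → k} {p : Fin n → Fin (3 + 1) → k} {c : Fin n → k}
    (hp : ∀ j, p j = c j • (Fin.cons 1 (q j) : Fin 4 → k)) (s : ℕ) :
    Lift (W q s) s (fatIdeal p (fun _ => 1)) := by
  intro g hg
  obtain ⟨G, h1, h2⟩ := hom_exists hg.1
  refine ⟨G, h1, ?_, h2⟩
  rw [fatIdeal, Ideal.mem_iInf]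
  intro j
  rw [pow_one]
  refine Ideal.subset_span ⟨⟨s, h1⟩, ?_⟩
  rw [hp j, eval_hsmul h1, ← eval_dh, h2, hg.2 j, mul_zero]

/-- the affine containment -/
def Good {n : ℕ} (q : Fin n → Fin 3 → k) : Prop :=
  ∀ (r t : ℕ) (f : A3 k), 1 ≤ r → f ≠ 0 → f ∈ PD k t → (∀ j, f ∈ mx (q j) ^ (3 * r)) →
    ∃ s u, f ∈ W q s ^ r * PD k u ∧ r * s + u = t ∧ 2 * r ≤ u

lemma pointIdeal_le {q : Fin 3 → k} {p : Fin (3 + 1) → k} {c : k} (hc : c ≠ 0)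
    (hp : p = c • (Fin.cons 1 q : Fin 4 → k)) :
    pointIdeal p ≤ (mx q).comap (dh k) := by
  refine Ideal.span_le.2 ?_
  rintro f ⟨⟨d, hd⟩, h⟩
  show dh k f ∈ mx q
  rw [mem_mx_one, eval_dh]
  rw [hp, eval_hsmul hd] at h
  exact (mul_eq_zero.1 h).resolve_left (pow_ne_zero _ hc)

lemma fat_homog {n : ℕ} (p : Fin n → Fin (3 + 1) → k) (m : Fin n → ℕ) {F : MvPolynomial (Fin 4) k}
    (hF : F ∈ fatIdeal p m) (i : ℕ) : homogeneousComponent i F ∈ fatIdeal p m := by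
  let _ : GradedRing (homogeneousSubmodule (Fin 4) k) := gradedAlgebra
  have hpt : ∀ j, (pointIdeal (p j)).IsHomogeneous (homogeneousSubmodule (Fin 4) k) := by
    intro j
    refine Ideal.homogeneous_span _ _ ?_
    rintro f ⟨⟨d, hd⟩, -⟩
    exact ⟨d, hd⟩
  have hpow : ∀ j a, (pointIdeal (p j) ^ a).IsHomogeneous (homogeneousSubmodule (Fin 4) k) := by
    intro j a
    induction a with
    | zero => rw [pow_zero, Ideal.one_eq_top]; exact Ideal.IsHomogeneous.top _
    | succ a ih => rw [pow_succ]; exact ih.mul (hpt j)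
  have hI : (fatIdeal p m).IsHomogeneous (homogeneousSubmodule (Fin 4) k) :=
    Ideal.IsHomogeneous.iInf fun j => hpow j _
  have := hI i hF
  rw [← decomposition.decompose'_apply]
  exact this

lemma transfer_pt [CharZero k] {n : ℕ} {q : Fin n → Fin 3 → k} {p : Fin n → Fin (3 + 1) → k}
    {c : Fin n → k} (hc : ∀ j, c j ≠ 0) (hp : ∀ j, p j = c j • (Fin.cons 1 (q j) : Fin 4 → k))
    (hq : Good q) (r : ℕ) (hr : 1 ≤ r) :
    fatIdeal p (fun _ => 3 * r) ≤ maxIdeal k 3 ^ (2 * r) * (fatIdeal p (fun _ => 1)) ^ r := by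
  intro F hF
  rw [← sum_homogeneousComponent F]
  refine Ideal.sum_mem _ fun t _ => ?_
  have hFt := fat_homog p _ hF t
  have hh := homogeneousComponent_isHomogeneous t F
  generalize homogeneousComponent t F = Ft at hFt hh
  by_cases h0 : Ft = 0
  · rw [h0]; exact zero_mem _
  obtain ⟨s, u, h1, h2, h3⟩ := hq r t (dh k Ft) hr (fun h => h0 (dh_inj hh h)) (dh_PD hh) (fun j => by
    rw [fatIdeal, Ideal.mem_iInf] at hFt
    have h4 := hFt j
    have h5 := Ideal.pow_right_mono (pointIdeal_le (hc j) (hp j)) (3 * r) h4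
    exact Ideal.le_comap_pow (dh k) (3 * r) h5)
  obtain ⟨G, g1, g2, g3⟩ := ((Lift_W hp s).pow r).mul (Lift_PD u) _ h1
  rw [h2] at g1
  have : Ft = G := by
    have := dh_inj (hh.sub g1) (by rw [map_sub, g3, sub_self])
    rwa [sub_eq_zero] at this
  rw [this, mul_comm]
  exact Ideal.mul_mono_right (Ideal.pow_le_pow_right h3) g2

lemma transfer [CharZero k] {n : ℕ} (h : GenA k n Good) :
    Generic k 3 n (fun p => ∀ r : ℕ, 1 ≤ r →
      fatIdeal p (fun _ => 3 * r) ≤ maxIdeal k 3 ^ (2 * r) * (fatIdeal p (fun _ => 1)) ^ r) := by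
  obtain ⟨Φ, hΦ, h⟩ := h
  set D := Φ.totalDegree
  let Ψ : MvPolynomial (Fin n × Fin (3 + 1)) k := (∏ j, X (j, 0)) * ∑ α ∈ Φ.support,
    C (coeff α Φ) * ∏ x : Fin n × Fin 3, (X (x.1, x.2.succ) ^ (α x) * X (x.1, 0) ^ (D - α x))
  have hle : ∀ α ∈ Φ.support, ∀ x, α x ≤ D := fun α hα x =>
    (Finsupp.le_degree x α).trans (by
      have := le_totalDegree hα
      rw [Finsupp.sum_fintype _ _ (fun _ => rfl)] at this
      rwa [Finsupp.degree_eq_sum])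
  have hΨ : ∀ p : Fin n → Fin (3 + 1) → k, (∀ j, p j 0 ≠ 0) → eval (fun x => p x.1 x.2) Ψ =
      (∏ j, p j 0) * ((∏ x : Fin n × Fin 3, p x.1 0 ^ D) *
        evc (fun j a => p j a.succ / p j 0) Φ) := by
    intro p hp
    simp only [Ψ, map_mul, map_sum, map_prod, map_pow, eval_X, eval_C, evc]
    rw [eval_eq']
    refine congrArg (fun z => (∏ j, p j 0) * z) ?_
    rw [Finset.mul_sum]
    refine Finset.sum_congr rfl fun α hα => ?_
    rw [mul_left_comm, ← Finset.prod_mul_distrib]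
    congr 1
    refine Finset.prod_congr rfl fun x _ => ?_
    have h1 := hle α hα x
    have h2 := hp x.1
    obtain ⟨e, he⟩ := Nat.exists_eq_add_of_le h1
    rw [he, Nat.add_sub_cancel_left, pow_add, div_pow]
    field_simp
  refine ⟨{Ψ}, ?_, ?_⟩
  · obtain ⟨x, hx⟩ : ∃ x, eval x Φ ≠ 0 := by
      by_contra! hx
      exact hΦ (MvPolynomial.funext fun x => by rw [hx, map_zero])
    refine ⟨fun j => Fin.cons 1 (fun a => x (j, a)), fun j hj => ?_, Ψ, rfl, ?_⟩
    · have := congrFun hj 0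
      simp at this
    · have h1 := hΨ (fun j => Fin.cons 1 (fun a => x (j, a))) (by simp)
      rw [h1]
      simpa [evc] using hx
  · rintro p - ⟨f, hf, hne⟩
    rw [Set.mem_singleton_iff] at hf
    subst hf
    have hp : ∀ j, p j 0 ≠ 0 := by
      intro j hj
      apply hne
      simp only [Ψ, map_mul, map_prod, eval_X]
      rw [Finset.prod_eq_zero (Finset.mem_univ j) hj, zero_mul]
    rw [hΨ p hp] at hne
    have hq := h (fun j a => p j a.succ / p j 0) (right_ne_zero_of_mul (right_ne_zero_of_mul hne))
    refine transfer_pt hp (fun j => ?_) hq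
    funext i
    refine Fin.cases ?_ (fun a => ?_) i
    · simp
    · have := hp j
      simp
      field_simp

end FP

namespace FP
variable {k : Type*} [Field k]

lemma Vol_of_sub {n n' s : ℕ} {q : Fin n' → Fin 3 → k} (e : Fin n → Fin n')
    (h : Vol s (fun j => q (e j))) : Vol s q :=
  fun t M F h1 h2 h3 => h t M F h1 h2 fun j => h3 (e j)

lemma Vol_gen {n n' s : ℕ} (h : n ≤ n') (hv : GenA k n (Vol s)) : GenA k n' (Vol s) :=
  (hv.pull (Fin.castLEEmb h)).mono fun _ hq => Vol_of_sub _ hq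

lemma good_std {n d : ℕ} {q : Fin n → Fin 3 → k} (hS : Sep q d) (hV : Vol (d + 3) q) : Good q := by
  intro r t f hr h0 hf hm
  have h1 := hV t (3 * r) f h0 hf hm
  have h2 : r * (d + 1) + 2 * r ≤ t := by nlinarith
  refine ⟨d + 1, t - r * (d + 1), regularity hS (by omega) hf (fun j => ?_), by omega, by omega⟩
  exact Ideal.pow_le_pow_right (by omega) (hm j)

lemma PD_one_pow (r : ℕ) : PD k 1 ^ r ≤ PD k r := by
  induction r with
  | zero =>
    rw [pow_zero, Submodule.one_le]
    exact one_mem_PD 0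
  | succ r ih =>
    rw [pow_succ]
    exact (mul_le_mul' ih le_rfl).trans (PD_mul_le r 1)

lemma good_L9 {n d : ℕ} {q : Fin n → Fin 3 → k} (hS : Sep q d) (hV : Vol (d + 2) q)
    (hW : W q (d + 1) ≤ W q d * PD k 1) : Good q := by
  intro r t f hr h0 hf hm
  have h1 := hV t (3 * r) f h0 hf hm
  have h2 : r * (d + 1) + r ≤ t := by nlinarith
  have h3 : r * (d + 1) = r * d + r := by ring
  refine ⟨d, t - r * d, ?_, by omega, by omega⟩
  have h4 := regularity hS (by omega) hf (fun j => Ideal.pow_le_pow_right (by omega) (hm j) :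
    ∀ j, f ∈ mx (q j) ^ r)
  have h5 : W q (d + 1) ^ r * PD k (t - r * (d + 1)) ≤ W q d ^ r * PD k (t - r * d) := by
    calc W q (d + 1) ^ r * PD k (t - r * (d + 1)) 
        ≤ (W q d * PD k 1) ^ r * PD k (t - r * (d + 1)) :=
          mul_le_mul' (pow_le_pow_left' hW r) le_rfl
      _ = W q d ^ r * (PD k 1 ^ r * PD k (t - r * (d + 1))) := by rw [mul_pow, mul_assoc]
      _ ≤ W q d ^ r * PD k (t - r * d) := by
          refine mul_le_mul' le_rfl ?_
          refine (mul_le_mul' (PD_one_pow r) le_rfl).trans ((PD_mul_le _ _).trans ?_)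
          exact PD_mono (by omega)
  exact h5 h4

lemma Dp_succ (α : Fin 3 →₀ ℕ) (i : Fin 3) :
    Dp k (α + Finsupp.single i 1) = Dp k α * (X i - C (α i : k)) := by
  have : ∀ j, ∏ c ∈ Finset.range ((α + Finsupp.single i 1 : Fin 3 →₀ ℕ) j), (X j - C (c : k) : A3 k) =
      (∏ c ∈ Finset.range (α j), (X j - C (c : k))) * (if j = i then X i - C (α i : k) else 1) := by
    intro j
    by_cases h : j = i
    · subst h
      simp [Finset.prod_range_succ]
    · simp [h, Finsupp.single_apply, Ne.symm h]
  rw [Dp, Finset.prod_congr rfl fun j _ => this j, Finset.prod_mul_distrib, Dp]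
  simp

lemma Dp_span (t : ℕ) : PD k t ≤ Submodule.span k (Dp k '' {α | α.degree ≤ t}) := by
  have hmono : ∀ t, Submodule.span k (Dp k '' {α | α.degree ≤ t}) ≤
      Submodule.span k (Dp k '' {α | α.degree ≤ t + 1}) := fun t =>
    Submodule.span_mono (Set.image_mono fun α (h : α.degree ≤ t) => Nat.le_succ_of_le h)
  have hC : ∀ t c, C c ∈ Submodule.span k (Dp k '' {α | α.degree ≤ t}) := by
    intro t c
    have : (C c : A3 k) = c • Dp k 0 := by simp [Dp, smul_eq_C_mul]
    rw [this]
    exact Submodule.smul_mem _ _ (Submodule.subset_span ⟨0, by simp, rfl⟩)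
  induction t with
  | zero =>
    intro f hf
    rw [mem_PD, Nat.le_zero, totalDegree_eq_zero_iff_eq_C] at hf
    rw [hf]
    exact hC _ _
  | succ t ih =>
    intro f hf
    obtain ⟨F, h1, h2⟩ := div_zero_aux hf
    rw [h2]
    refine add_mem (hC _ _) (Submodule.sum_mem _ fun a _ => ?_)
    have h3 := ih (h1 a)
    generalize F a = G at h3
    induction h3 using Submodule.span_induction with
    | mem x hx =>
      obtain ⟨α, hα, rfl⟩ := hx
      have h4 : X a * Dp k α = Dp k (α + Finsupp.single a 1) + (α a : k) • Dp k α := by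
        rw [Dp_succ, smul_eq_C_mul]; ring
      rw [h4]
      refine add_mem (Submodule.subset_span ⟨_, ?_, rfl⟩) (Submodule.smul_mem _ _ (Submodule.subset_span ⟨_, ?_, rfl⟩))
      · have : α.degree ≤ t := hα
        simpa using this
      · exact Nat.le_succ_of_le hα
    | zero => simp
    | add x y _ _ hx hy => rw [mul_add]; exact add_mem hx hy
    | smul c x _ hx => rw [mul_smul_comm]; exact Submodule.smul_mem _ _ hx

/-- the four linear forms -/
noncomputable def yv (k : Type*) [Field k] : Fin 4 → A3 k := Fin.cons 1 X

lemma yv_PD (μ : Fin 4) : yv k μ ∈ PD k 1 := by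
  refine Fin.cases ?_ (fun j => ?_) μ
  · exact one_mem_PD 1
  · exact X_mem_PD j

/-- the evaluation map on the span of the `D` -/
noncomputable def BL {n : ℕ} (a : Fin n → Fin 3 →₀ ℕ) (q : Fin n → Fin 3 → k) : (Fin n → k) →ₗ[k] (Fin n → k) where
  toFun v j := ∑ i, v i * eval (q j) (Dp k (a i))
  map_add' v w := by funext j; simp [add_mul, Finset.sum_add_distrib]
  map_smul' c v := by funext j; simp [Finset.mul_sum, mul_assoc]

lemma BL_inj [CharZero k] {n : ℕ} {a : Fin n → Fin 3 →₀ ℕ} (ha : Function.Injective a) :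
    Function.Injective (BL a (fun j => lp k (a j))) := by
  classical
  rw [injective_iff_map_eq_zero]
  intro v hv
  by_contra h0
  have hne : (Finset.univ.filter fun i => v i ≠ 0).Nonempty := by
    obtain ⟨i, hi⟩ := Function.ne_iff.1 h0
    exact ⟨i, by simpa using hi⟩
  obtain ⟨i, hi, hmin⟩ := Finset.exists_min_image _ (fun i => (a i).degree) hne
  have hi' : v i ≠ 0 := by simpa using hi
  have h1 : ∑ l, v l * eval (lp k (a i)) (Dp k (a l)) = 0 := congrFun hv i
  rw [Finset.sum_eq_single i] at h1
  · rcases mul_eq_zero.1 h1 with h | h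
    · exact hi' h
    · exact Dp_eval_ne.2 le_rfl h
  · intro l _ hl
    by_contra h2
    have h3 := Dp_eval_ne.1 (right_ne_zero_of_mul h2)
    exact hl (ha (eq_of_le_degree h3 (hmin l (by simpa using left_ne_zero_of_mul h2))))
  · simp

lemma BL_gen [CharZero k] {n : ℕ} {a : Fin n → Fin 3 →₀ ℕ} (ha : Function.Injective a) :
    GenA k n (fun q => Function.Injective (BL a q)) := by
  refine GenA.mono (GenA_surj (BL a) (fun j i => ?_) (fun j => lp k (a j)) ?_) fun q hq => ?_
  · obtain ⟨P, hP⟩ := jet_poly (k := k) j (Dp k (a i)) 0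
    refine ⟨P, fun q => ?_⟩
    rw [← hP q]
    rw [eval_tr]
    simp [BL, Pi.single_apply]
  · exact LinearMap.injective_iff_surjective.1 (BL_inj ha)
  · exact LinearMap.injective_iff_surjective.2 hq

end FP

namespace FP
variable {k : Type*} [Field k]

/-- the component polynomials -/
noncomputable def cmp (k : Type*) [Field k] (n d : ℕ) (μ : Fin 4) :
    ((Fin 4 × Idx (d + 1)) ⊕ Fin n → k) →ₗ[k] A3 k :=
  par k (d + 1) ∘ₗ LinearMap.funLeft k k (fun α => Sum.inl (μ, α))

/-- the combined polynomial -/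
noncomputable def tot {n : ℕ} (a : Fin n → Fin 3 →₀ ℕ) (d : ℕ) :
    ((Fin 4 × Idx (d + 1)) ⊕ Fin n → k) →ₗ[k] A3 k :=
  (∑ μ : Fin 4, LinearMap.mulRight k (yv k μ) ∘ₗ cmp k n d μ) +
    ∑ i : Fin n, LinearMap.toSpanSingleton k _ (Dp k (a i)) ∘ₗ LinearMap.proj (Sum.inr i)

lemma tot_apply {n : ℕ} (a : Fin n → Fin 3 →₀ ℕ) (d : ℕ) (v : (Fin 4 × Idx (d + 1)) ⊕ Fin n → k) :
    tot a d v = ∑ μ, cmp k n d μ v * yv k μ + ∑ i, v (Sum.inr i) • Dp k (a i) := by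
  simp [tot]

/-- the multiplication-evaluation map -/
noncomputable def Th {n : ℕ} (a : Fin n → Fin 3 →₀ ℕ) (d : ℕ) (q : Fin n → Fin 3 → k) :
    ((Fin 4 × Idx (d + 1)) ⊕ Fin n → k) →ₗ[k] (Idx (d + 2) ⊕ (Fin 4 × Fin n) → k) :=
  LinearMap.pi fun x => Sum.elim (fun β => lcoeff k β.1 ∘ₗ tot a d)
    (fun y => (aeval (R := k) (q y.2)).toLinearMap ∘ₗ cmp k n d y.1) x

lemma Th_inl {n : ℕ} (a : Fin n → Fin 3 →₀ ℕ) (d : ℕ) (q : Fin n → Fin 3 → k) (v) (β : Idx (d + 2)) :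
    Th a d q v (Sum.inl β) = coeff β.1 (tot a d v) := rfl

lemma Th_inr {n : ℕ} (a : Fin n → Fin 3 →₀ ℕ) (d : ℕ) (q : Fin n → Fin 3 → k) (v) (μ : Fin 4) (j : Fin n) :
    Th a d q v (Sum.inr (μ, j)) = eval (q j) (cmp k n d μ v) := by
  rw [← coe_aeval_eq_eval]; rfl

/-- the lattice decomposition -/
lemma lattice_dec [CharZero k] {n d : ℕ} {a : Fin n → Fin 3 →₀ ℕ} (ha : ∀ j, (a j).degree ≤ d)
    (hlow : ∀ α : Fin 3 →₀ ℕ, α.degree < d → ∃ j, a j = α)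
    (hdec : ∀ α : Fin 3 →₀ ℕ, α.degree = d + 1 → ∃ i γ, α = γ + Finsupp.single i 1 ∧ ∀ j, a j ≠ γ)
    {g : A3 k} (hg : g ∈ PD k (d + 1)) :
    ∃ h : Fin 4 → A3 k, (∀ μ, h μ ∈ W (fun j => lp k (a j)) d) ∧ ∃ v : Fin n → k,
      g = ∑ μ, h μ * yv k μ + ∑ i, v i • Dp k (a i) := by
  have hW : ∀ γ : Fin 3 →₀ ℕ, γ.degree = d → (∀ j, a j ≠ γ) → Dp k γ ∈ W (fun j => lp k (a j)) d := by
    intro γ h1 h2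
    refine ⟨h1 ▸ Dp_PD γ, fun j => ?_⟩
    by_contra h3
    exact h2 j (eq_of_le_degree (Dp_eval_ne.1 h3) (h1 ▸ ha j)).symm
  replace hg := Dp_span _ hg
  induction hg using Submodule.span_induction with
  | mem x hx =>
    obtain ⟨α, hα, rfl⟩ := hx
    have hα : α.degree ≤ d + 1 := hα
    rcases Nat.lt_or_eq_of_le hα with h1 | h1
    · by_cases h2 : ∃ j, a j = α
      · obtain ⟨j, rfl⟩ := h2
        refine ⟨0, fun _ => zero_mem _, Pi.single j 1, ?_⟩
        simp [Pi.single_apply]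
      · have h3 : α.degree = d := by
          by_contra h4
          exact h2 (hlow α (by omega))
        refine ⟨Pi.single 0 (Dp k α), fun μ => ?_, 0, ?_⟩
        · by_cases hμ : μ = 0
          · subst hμ; rw [Pi.single_eq_same]; exact hW α h3 (by simpa using h2)
          · rw [Pi.single_eq_of_ne hμ]; exact zero_mem _
        · simp [Pi.single_apply, yv]
    · obtain ⟨i, γ, rfl, h2⟩ := hdec α h1
      have h3 : γ.degree = d := by simpa using h1
      have hw := hW γ h3 h2
      refine ⟨Fin.cons (C (-(γ i : k)) * Dp k γ) (Pi.single i (Dp k γ)), fun μ => ?_, 0, ?_⟩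
      · refine Fin.cases ?_ (fun l => ?_) μ
        · exact C_mul_mem _ hw
        · rw [Fin.cons_succ]
          by_cases hμ : l = i
          · subst hμ; rw [Pi.single_eq_same]; exact hw
          · rw [Pi.single_eq_of_ne hμ]; exact zero_mem _
      · rw [Dp_succ, Fin.sum_univ_succ]
        simp only [Fin.cons_zero, Fin.cons_succ, yv, Pi.single_apply]
        simp
        ring
  | zero => exact ⟨0, fun _ => zero_mem _, 0, by simp⟩
  | add x y _ _ hx hy =>
    obtain ⟨h, h1, v, rfl⟩ := hx
    obtain ⟨h', h1', v', rfl⟩ := hy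
    refine ⟨h + h', fun μ => add_mem (h1 μ) (h1' μ), v + v', ?_⟩
    simp only [Pi.add_apply, add_mul, add_smul, Finset.sum_add_distrib]
    ring
  | smul c x _ hx =>
    obtain ⟨h, h1, v, rfl⟩ := hx
    refine ⟨c • h, fun μ => Submodule.smul_mem _ _ (h1 μ), c • v, ?_⟩
    simp only [Pi.smul_apply, smul_add, Finset.smul_sum, smul_mul_assoc, smul_smul, smul_eq_mul]

lemma tot_PD {n d : ℕ} {a : Fin n → Fin 3 →₀ ℕ} (ha : ∀ j, (a j).degree ≤ d)
    (v : (Fin 4 × Idx (d + 1)) ⊕ Fin n → k) : tot a d v ∈ PD k (d + 1) := by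
  rw [tot_apply]
  refine add_mem (Submodule.sum_mem _ fun μ _ => PD_mul (par_mem d _) (yv_PD μ))
    (Submodule.sum_mem _ fun i _ => Submodule.smul_mem _ _ (PD_mono ?_ (Dp_PD (a i))))
  have := ha i
  omega

lemma PD_ext {d : ℕ} {f g : A3 k} (hf : f ∈ PD k d) (hg : g ∈ PD k d)
    (h : ∀ β : Idx (d + 1), coeff β.1 f = coeff β.1 g) : f = g := by
  rw [← par_surj hf, ← par_surj hg]
  congr 1
  funext β
  exact h β

lemma Th_surj [CharZero k] {n d : ℕ} {a : Fin n → Fin 3 →₀ ℕ} (hinj : Function.Injective a)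
    (ha : ∀ j, (a j).degree ≤ d)
    (hlow : ∀ α : Fin 3 →₀ ℕ, α.degree < d → ∃ j, a j = α)
    (hdec : ∀ α : Fin 3 →₀ ℕ, α.degree = d + 1 → ∃ i γ, α = γ + Finsupp.single i 1 ∧ ∀ j, a j ≠ γ) :
    Function.Surjective (Th a d (fun j => lp k (a j))) := by
  intro w
  have hS := Sep_lattice (k := k) a hinj ha
  choose f0 f1 f2 using fun μ : Fin 4 => hS (fun j => w (Sum.inr (μ, j)))
  have hG : par k (d + 2) (fun β => w (Sum.inl β)) ∈ PD k (d + 1) := par_mem (d + 1) _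
  set G := par k (d + 2) (fun β => w (Sum.inl β)) with hGdef
  have hg : G - ∑ μ, f0 μ * yv k μ ∈ PD k (d + 1) :=
    sub_mem hG (Submodule.sum_mem _ fun μ _ => PD_mul (f1 μ) (yv_PD μ))
  obtain ⟨h, h1, v, h2⟩ := lattice_dec ha hlow hdec hg
  let V : (Fin 4 × Idx (d + 1)) ⊕ Fin n → k :=
    Sum.elim (fun x => coeff x.2.1 (f0 x.1 + h x.1)) v
  have hc : ∀ μ, cmp k n d μ V = f0 μ + h μ := fun μ => par_surj (add_mem (f1 μ) (h1 μ).1)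
  have ht : tot a d V = G := by
    rw [tot_apply]
    simp only [hc, add_mul, Finset.sum_add_distrib]
    have : ∀ i, V (Sum.inr i) = v i := fun i => rfl
    simp only [this]
    rw [add_assoc, ← h2]
    ring
  refine ⟨V, funext fun x => ?_⟩
  rcases x with β | ⟨μ, j⟩
  · rw [Th_inl, ht, hGdef, coeff_par]
  · rw [Th_inr, hc, map_add, f2, (h1 μ).2 j, add_zero]

lemma W_gen [CharZero k] {n d : ℕ} {a : Fin n → Fin 3 →₀ ℕ} (hinj : Function.Injective a)
    (ha : ∀ j, (a j).degree ≤ d)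
    (hlow : ∀ α : Fin 3 →₀ ℕ, α.degree < d → ∃ j, a j = α)
    (hdec : ∀ α : Fin 3 →₀ ℕ, α.degree = d + 1 → ∃ i γ, α = γ + Finsupp.single i 1 ∧ ∀ j, a j ≠ γ) :
    GenA k n (fun q => W q (d + 1) ≤ W q d * PD k 1) := by
  have hT : GenA k n (fun q => Function.Surjective (Th a d q)) := by
    refine GenA_surj (Th a d) ?_ _ (Th_surj hinj ha hlow hdec)
    rintro (β | ⟨μ, j⟩) c
    · exact ⟨C (coeff β.1 (tot a d (Pi.single c 1))), fun q => by rw [Th_inl, evc, eval_C]⟩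
    · obtain ⟨P, hP⟩ := jet_poly (k := k) j (cmp k n d μ (Pi.single c 1)) 0
      exact ⟨P, fun q => by rw [← hP q, eval_tr, Th_inr]⟩
  refine (hT.and (BL_gen hinj)).mono ?_
  rintro q ⟨hq1, hq2⟩ f hf
  obtain ⟨v, hv⟩ := hq1 (Sum.elim (fun β => coeff β.1 f) 0)
  have hft : tot a d v = f := by
    refine PD_ext (tot_PD ha v) hf.1 fun β => ?_
    rw [← Th_inl a d q v β, hv]; rfl
  have hc : ∀ μ, cmp k n d μ v ∈ W q d := by
    intro μ
    refine ⟨par_mem d _, fun j => ?_⟩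
    rw [← Th_inr a, hv]; rfl
  have hv0 : (fun i => v (Sum.inr i)) = 0 := by
    apply hq2
    rw [map_zero]
    funext j
    have h1 : eval (q j) (tot a d v) = 0 := by rw [hft]; exact hf.2 j
    rw [tot_apply, map_add, map_sum, Finset.sum_eq_zero, zero_add, map_sum] at h1
    · simpa [BL] using h1
    · intro μ _
      rw [map_mul, (hc μ).2 j, zero_mul]
  rw [← hft, tot_apply]
  have : ∀ i, v (Sum.inr i) = 0 := fun i => congrFun hv0 i
  simp only [this, zero_smul, Finset.sum_const_zero, add_zero]
  exact Submodule.sum_mem _ fun μ _ => Submodule.mul_mem_mul (hc μ) (yv_PD μ)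

/-- finset version -/
lemma W_gen_finset [CharZero k] {n d : ℕ} (T : Finset (Fin 3 →₀ ℕ)) (hT : ∀ α ∈ T, α.degree = d)
    (hn : 6 * n = d * (d + 1) * (d + 2) + 6 * T.card)
    (hdec : ∀ α : Fin 3 →₀ ℕ, α.degree = d + 1 → ∃ i γ, α = γ + Finsupp.single i 1 ∧ γ ∉ T) :
    GenA k n (fun q => W q (d + 1) ≤ W q d * PD k 1) := by
  classical
  have hdisj : Disjoint (lowf d) T := by
    rw [Finset.disjoint_left]
    intro α h1 h2
    have := mem_lowf.1 h1
    have := hT α h2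
    omega
  have hcard : (lowf d ∪ T).card = n := by
    rw [Finset.card_union_of_disjoint hdisj]
    have := card_lowf d
    omega
  let e := (Finset.equivFinOfCardEq hcard).symm
  refine W_gen (a := fun j => (e j).1) (fun i j h => e.injective (Subtype.ext h)) (fun j => ?_)
    (fun α hα => ?_) (fun α hα => ?_)
  · rcases Finset.mem_union.1 (e j).2 with h | h
    · exact (mem_lowf.1 h).le
    · exact (hT _ h).le
  · exact ⟨e.symm ⟨α, Finset.mem_union_left _ (mem_lowf.2 hα)⟩, by simp⟩
  · obtain ⟨i, γ, h1, h2⟩ := hdec α hα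
    refine ⟨i, γ, h1, fun j hj => ?_⟩
    rcases Finset.mem_union.1 (e j).2 with h | h
    · rw [hj] at h
      have := mem_lowf.1 h
      rw [h1] at hα
      simp at hα
      omega
    · exact h2 (hj ▸ h)

/-- explicit exponent vectors -/
noncomputable def ev (v : Fin 3 → ℕ) : Fin 3 →₀ ℕ := Finsupp.equivFunOnFinite.symm v

lemma ev_inj : Function.Injective ev := Finsupp.equivFunOnFinite.symm.injective

lemma dec_aux {d : ℕ} {T : Finset (Fin 3 → ℕ)}
    (h : ∀ a b c : Fin (d + 2), a.1 + b.1 + c.1 = d + 1 → ∃ i : Fin 3, ![a.1, b.1, c.1] i ≠ 0 ∧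
      (fun l => if l = i then ![a.1, b.1, c.1] l - 1 else ![a.1, b.1, c.1] l) ∉ T)
    (α : Fin 3 →₀ ℕ) (hα : α.degree = d + 1) :
    ∃ i γ, α = γ + Finsupp.single i 1 ∧ γ ∉ T.image ev := by
  have hs : α 0 + α 1 + α 2 = d + 1 := by
    rw [← hα, Finsupp.degree_eq_sum, Fin.sum_univ_three]
  obtain ⟨i, h1, h2⟩ := h ⟨α 0, by omega⟩ ⟨α 1, by omega⟩ ⟨α 2, by omega⟩ hs
  have hv : (![α 0, α 1, α 2] : Fin 3 → ℕ) = α := by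
    funext l; fin_cases l <;> rfl
  simp only [hv] at h1 h2
  refine ⟨i, ev (fun l => if l = i then α l - 1 else α l), ?_, ?_⟩
  · ext l
    by_cases hl : l = i
    · subst hl
      simp [ev]; omega
    · simp [ev, hl]
  · rw [Finset.mem_image]
    rintro ⟨w, hw, hw2⟩
    exact h2 (ev_inj hw2 ▸ hw)

lemma W_gen_3 [CharZero k] {n : ℕ} (h1 : 11 ≤ n) (h2 : n ≤ 14) :
    GenA k n (fun q => W q (3 + 1) ≤ W q 3 * PD k 1) := by
  let T4 : Finset (Fin 3 → ℕ) := {![1, 2, 0], ![0, 1, 2], ![2, 0, 1], ![1, 1, 1]}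
  have hT4 : T4.card = 4 := by decide
  obtain ⟨T, hT, hc⟩ := Finset.exists_subset_card_eq (s := T4) (n := n - 10) (by omega)
  refine W_gen_finset (d := 3) (T.image ev) ?_ ?_ ?_
  · intro α hα
    obtain ⟨w, hw, rfl⟩ := Finset.mem_image.1 hα
    have hw' := hT hw
    have hall : ∀ w ∈ T4, w 0 + w 1 + w 2 = 3 := by decide
    rw [Finsupp.degree_eq_sum, Fin.sum_univ_three]
    show w 0 + w 1 + w 2 = 3
    exact hall w hw'
  · rw [Finset.card_image_of_injective _ ev_inj, hc]; omega
  · refine fun α hα => ?_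
    obtain ⟨i, γ, g1, g2⟩ := dec_aux (d := 3) (T := T4) (by decide) α hα
    exact ⟨i, γ, g1, fun h => g2 (Finset.image_subset_image hT h)⟩

lemma W_gen_4 [CharZero k] : GenA k 21 (fun q => W q (4 + 1) ≤ W q 4 * PD k 1) := by
  refine W_gen_finset (d := 4) (({![2, 1, 1]} : Finset (Fin 3 → ℕ)).image ev) ?_ ?_
    (dec_aux (d := 4) (by decide))
  · intro α hα
    obtain ⟨w, hw, rfl⟩ := Finset.mem_image.1 hα
    rw [Finset.mem_singleton] at hw
    subst hw
    rw [Finsupp.degree_eq_sum, Fin.sum_univ_three]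
    rfl
  · rw [Finset.card_image_of_injective _ ev_inj]; rfl

lemma good_a [CharZero k] {n d m : ℕ} (h1 : 6 * n ≤ (d + 1) * (d + 2) * (d + 3)) (hm : m ≤ n)
    (hv : GenA k m (Vol (d + 3))) : GenA k n Good :=
  ((Sep_gen h1).and (Vol_gen hm hv)).mono fun _ h => good_std h.1 h.2

lemma good_grid [CharZero k] {n d : ℕ} (g m : ℕ) (h1 : 6 * n ≤ (d + 1) * (d + 2) * (d + 3))
    (hg : 1 ≤ g) (hm : m ≤ n) (hm2 : m ≤ g ^ 3) (hs : (d + 3) * g ^ 2 < 3 * m) : GenA k n Good :=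
  good_a h1 hm (grid_vol hg hm2 hs)

lemma good_all [CharZero k] {n : ℕ} (hn1 : 5 ≤ n) (hn2 : n ≤ 511) : GenA k n Good := by
  by_cases h : n ≤ 10
  · exact good_a (d := 2) (by omega) hn1 vol5
  by_cases h : n ≤ 14
  · refine (((Sep_gen (d := 3) (by omega)).and (Vol_gen hn1 vol5)).and
      (W_gen_3 (by omega) h)).mono fun _ h => good_L9 h.1.1 h.1.2 h.2
  by_cases h : n ≤ 20
  · exact good_a (d := 3) (m := 15) (by omega) (by omega) vol15
  by_cases h : n ≤ 21
  · obtain rfl : n = 21 := by omega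
    exact (((Sep_gen (d := 4) (by omega)).and (Vol_gen (by omega) vol15)).and
      W_gen_4).mono fun _ h => good_L9 h.1.1 h.1.2 h.2
  by_cases h : n ≤ 26
  · exact good_grid (d := 4) 3 n (by omega) (by omega) (by omega) (by omega) (by omega)
  by_cases h : n ≤ 35
  · exact good_grid (d := 4) 3 27 (by omega) (by omega) (by omega) (by omega) (by omega)
  by_cases h : n ≤ 56
  · exact good_grid (d := 5) 3 27 (by omega) (by omega) (by omega) (by omega) (by omega)
  by_cases h : n ≤ 63
  · exact good_grid (d := 6) 4 n (by omega) (by omega) (by omega) (by omega) (by omega)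
  by_cases h : n ≤ 84
  · exact good_grid (d := 6) 4 64 (by omega) (by omega) (by omega) (by omega) (by omega)
  by_cases h : n ≤ 120
  · exact good_grid (d := 7) 4 64 (by omega) (by omega) (by omega) (by omega) (by omega)
  by_cases h : n ≤ 165
  · exact good_grid (d := 8) 4 64 (by omega) (by omega) (by omega) (by omega) (by omega)
  by_cases h : n ≤ 220
  · exact good_grid (d := 9) 5 125 (by omega) (by omega) (by omega) (by omega) (by omega)
  by_cases h : n ≤ 286
  · exact good_grid (d := 10) 5 125 (by omega) (by omega) (by omega) (by omega) (by omega)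
  by_cases h : n ≤ 364
  · exact good_grid (d := 11) 5 125 (by omega) (by omega) (by omega) (by omega) (by omega)
  by_cases h : n ≤ 455
  · exact good_grid (d := 12) 6 216 (by omega) (by omega) (by omega) (by omega) (by omega)
  · exact good_grid (d := 13) 6 216 (by omega) (by omega) (by omega) (by omega) (by omega)

end FP

/-- For every `5 ≤ n ≤ 511` and points in general position in `ℙ³`, the radical ideal
`I = ⋂ⱼ m_{pⱼ}` satisfies `I^(3r) ⊆ M^(2r) * I^r` for all `r ≥ 1`. -/
theorem statement17 (k : Type*) [Field k] [CharZero k] (n : ℕ)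
    (hn1 : 5 ≤ n) (hn2 : n ≤ 511) :
    Generic k 3 n (fun p =>
      ∀ r : ℕ, 1 ≤ r →
        fatIdeal p (fun _ => 3 * r) ≤
          maxIdeal k 3 ^ (2 * r) * (fatIdeal p (fun _ => 1)) ^ r) :=
  FP.transfer (FP.good_all hn1 hn2)
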